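/- arXiv:2503.22043 — 10 statements merged into one kernel-verified Lean document; each statement's English description precedes it below -/
import Mathlib

section
/- Let n ≥ 1 be an integer, and let (a_1,…,a_{n+1}) and (b_1,…,b_n) be sequences of positive integers such that (1) a_1 and a_{n+1} are odd while a_2,…,a_n are all even, and (2) for every subset I ⊆ {1,…,n} one has Σ_{i∈I} b_i ≠ Σ_{i∉I} b_i (the sequence (b_1,…,b_n) cannot be split into two disjoint subsequences with equal sums). Then the binary word W = 1^{a_1} 0^{b_1} 1^{a_2} 0^{b_2} ⋯ 1^{a_n} 0^{b_n} 1^{a_{n+1}} is not a shuffle square. -/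
/-- `Interleave x y z` means that `z` is an interleaving (shuffle) of the words
`x` and `y`. -/
inductive Interleave {α : Type*} : List α → List α → List α → Prop
  | nil : Interleave [] [] []
  | cons_left (a : α) {xs ys zs : List α} :
      Interleave xs ys zs → Interleave (a :: xs) ys (a :: zs)
  | cons_right (a : α) {xs ys zs : List α} :
      Interleave xs ys zs → Interleave xs (a :: ys) (a :: zs)

/-- A word is a shuffle square if it is an interleaving of two copies of the same word. -/
def IsShuffleSquare {α : Type*} (w : List α) : Prop :=
  ∃ x : List α, Interleave x x w

/-- If `w` is an interleaving of `x` and `y` with a leading block of a letter `c`, then that block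
splits into leading blocks of `x` and `y`. -/
theorem Interleave.exists_of_replicate_append {α : Type*} {c : α} {w : List α} {k : ℕ}
    {x y : List α} (h : Interleave x y (List.replicate k c ++ w)) :
    ∃ r s x' y', r + s = k ∧ x = List.replicate r c ++ x' ∧ y = List.replicate s c ++ y' ∧
      Interleave x' y' w := by
  induction k generalizing x y with
  | zero => exact ⟨0, 0, x, y, rfl, rfl, rfl, by simpa using h⟩
  | succ k ih =>
    rw [List.replicate_succ, List.cons_append] at h
    cases h with
    | cons_left _ h =>
      obtain ⟨r, s, x', y', hk, rfl, rfl, h'⟩ := ih h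
      exact ⟨r + 1, s, x', y', by omega, by simp [List.replicate_succ], rfl, h'⟩
    | cons_right _ h =>
      obtain ⟨r, s, x', y', hk, rfl, rfl, h'⟩ := ih h
      exact ⟨r, s + 1, x', y', by omega, rfl, by simp [List.replicate_succ], h'⟩

/-- The number of zeros (`false`) of a binary word, each counted with the sign `(-1) ^ h`, where
`h` is the number of ones (`true`) preceding it. -/
def signedZeros : List Bool → ℤ
  | [] => 0
  | true :: w => -signedZeros w
  | false :: w => 1 + signedZeros w

theorem signedZeros_replicate_true_append (r : ℕ) (w : List Bool) :
    signedZeros (List.replicate r true ++ w) = (-1) ^ r * signedZeros w := by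
  induction r with
  | zero => simp
  | succ r ih => simp [List.replicate_succ, signedZeros, ih, pow_succ]

theorem signedZeros_replicate_false_append (r : ℕ) (w : List Bool) :
    signedZeros (List.replicate r false ++ w) = r + signedZeros w := by
  induction r with
  | zero => simp
  | succ r ih =>
    simp only [List.replicate_succ, List.cons_append, signedZeros, ih]
    push_cast
    ring

/-- If every block of ones except possibly the last has even length, the signed zero counts of
the two interleaved words add up to a signed sum of the lengths of the blocks of zeros. -/
theorem Interleave.exists_signedZeros_add_eq_sum {n m : ℕ} {a b : ℕ → ℕ}
    (ha : ∀ i < n, Even (a i)) {x y : List Bool}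
    (h : Interleave x y ((((List.range n).map fun i =>
      List.replicate (a i) true ++ List.replicate (b i) false).flatten)
        ++ List.replicate m true)) :
    ∃ ε : ℕ → ℤˣ, signedZeros x + signedZeros y = ∑ i ∈ Finset.range n, (ε i : ℤ) * b i := by
  induction n generalizing a b x y with
  | zero =>
    rw [List.range_zero, List.map_nil, List.flatten_nil, List.nil_append,
      ← List.append_nil (List.replicate m true)] at h
    obtain ⟨r, s, x', y', -, rfl, rfl, h'⟩ := h.exists_of_replicate_append
    cases h'
    rw [signedZeros_replicate_true_append, signedZeros_replicate_true_append]
    simp [signedZeros]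
  | succ n ih =>
    rw [List.range_succ_eq_map, List.map_cons, List.flatten_cons, List.map_map,
      List.append_assoc, List.append_assoc] at h
    obtain ⟨r, s, x₁, y₁, hrs, rfl, rfl, h₁⟩ := h.exists_of_replicate_append
    obtain ⟨p, q, x₂, y₂, hpq, rfl, rfl, h₂⟩ := h₁.exists_of_replicate_append
    obtain ⟨ε, hε⟩ := ih (a := fun i => a (i + 1)) (b := fun i => b (i + 1))
      (fun i hi => ha (i + 1) (by omega)) h₂
    have hsign : (-1 : ℤ) ^ s = (-1) ^ r := by
      have hev : Even (r + s) := hrs ▸ ha 0 n.succ_pos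
      rw [Nat.even_add] at hev
      rcases Nat.even_or_odd r with hr | hr
      · rw [hr.neg_one_pow, (hev.1 hr).neg_one_pow]
      · have hs : Odd s := by
          rw [← Nat.not_even_iff_odd] at hr ⊢
          exact fun hs => hr (hev.2 hs)
        rw [hr.neg_one_pow, hs.neg_one_pow]
    refine ⟨fun i => (-1) ^ r * Nat.casesOn i 1 ε, ?_⟩
    rw [Finset.sum_range_succ']
    simp only [signedZeros_replicate_true_append, signedZeros_replicate_false_append, hsign,
      ← hpq, Units.val_mul, Units.val_pow_eq_pow_val, Units.val_neg, Units.val_one, mul_assoc,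
      ← Finset.mul_sum, ← hε]
    rw [show ((Nat.rec 1 (fun i _ => ε i) 0 : ℤˣ) : ℤ) = 1 from rfl]
    push_cast
    ring

theorem statement0 (n : ℕ) (hn : 1 ≤ n) (a b : ℕ → ℕ)
    (ha_pos : ∀ i ≤ n, 0 < a i) (hb_pos : ∀ i < n, 0 < b i)
    (ha0 : Odd (a 0)) (han : Odd (a n))
    (ha_even : ∀ i, 0 < i → i < n → Even (a i))
    (hb : ∀ I ⊆ Finset.range n, ∑ i ∈ I, b i ≠ ∑ i ∈ Finset.range n \ I, b i) :
    ¬ IsShuffleSquare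
      ((((List.range n).map fun i =>
          List.replicate (a i) true ++ List.replicate (b i) false).flatten)
        ++ List.replicate (a n) true) := by
  rintro ⟨x, hx⟩
  obtain ⟨n, rfl⟩ : ∃ k, n = k + 1 := ⟨n - 1, by omega⟩
  obtain ⟨k, hk⟩ := ha0
  set a' : ℕ → ℕ := fun i => Nat.casesOn i (2 * k) fun j => a (j + 1)
  have ha' : ∀ i < n + 1, Even (a' i) := by
    rintro (_ | i) hi
    · exact even_two_mul k
    · exact ha_even (i + 1) i.succ_pos hi
  have hword : ∀ t : List Bool, ((List.range (n + 1)).map fun i =>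
      List.replicate (a i) true ++ List.replicate (b i) false).flatten ++ t =
      true :: (((List.range (n + 1)).map fun i =>
        List.replicate (a' i) true ++ List.replicate (b i) false).flatten ++ t) := by
    intro t
    simp [List.range_succ_eq_map, hk, a', List.replicate_succ, Function.comp_def]
  rw [hword] at hx
  obtain ⟨u, v, huv, hsum⟩ : ∃ u v, signedZeros u + signedZeros v = 0 ∧
      Interleave u v (((List.range (n + 1)).map fun i =>
        List.replicate (a' i) true ++ List.replicate (b i) false).flatten ++
          List.replicate (a (n + 1)) true) := by
    cases hx with
    | cons_left _ h => exact ⟨_, _, by simp [signedZeros], h⟩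
    | cons_right _ h => exact ⟨_, _, by simp [signedZeros], h⟩
  obtain ⟨ε, hε⟩ := hsum.exists_signedZeros_add_eq_sum ha'
  rw [huv, ← Finset.sum_sdiff (Finset.filter_subset (ε · = 1) (Finset.range (n + 1)))] at hε
  refine hb _ (Finset.filter_subset (ε · = 1) _) ?_
  have hpos : ∑ i ∈ Finset.range (n + 1) with ε i = 1, (ε i : ℤ) * b i =
      ∑ i ∈ Finset.range (n + 1) with ε i = 1, (b i : ℤ) :=
    Finset.sum_congr rfl fun i hi => by simp [(Finset.mem_filter.1 hi).2]
  have hneg : ∑ i ∈ Finset.range (n + 1) \ {i ∈ Finset.range (n + 1) | ε i = 1}, (ε i : ℤ) * b i =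
      -∑ i ∈ Finset.range (n + 1) \ {i ∈ Finset.range (n + 1) | ε i = 1}, (b i : ℤ) := by
    rw [← Finset.sum_neg_distrib]
    refine Finset.sum_congr rfl fun i hi => ?_
    have hi' : ε i ≠ 1 := fun h =>
      (Finset.mem_sdiff.1 hi).2 (Finset.mem_filter.2 ⟨(Finset.mem_sdiff.1 hi).1, h⟩)
    simp [(Int.units_eq_one_or (ε i)).resolve_left hi']
  rw [hpos, hneg] at hε
  zify
  linarith
end

section
/- Let r ≥ 1 and m ≥ 1 be integers, and let a_1,…,a_{2m} be positive integers such that a_1 and a_{2m} are odd while a_2,…,a_{2m-1} are all even. Then the binary word W = 1^{a_1} 0^r 1^{a_2} 0^r 1^{a_3} ⋯ 1^{a_{2m-1}} 0^r 1^{a_{2m}} (with 2m−1 zero-runs, each of length r) is not a shuffle square. -/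
/-- A binary word decomposed as `n` zero-runs of length `r`, the `i`-th one followed by `a i`
ones. -/
def zeroRunBlocks (r n : ℕ) (a : ℕ → ℕ) : List Bool :=
  ((List.range n).map fun i => List.replicate r false ++ List.replicate (a i) true).flatten

/-- The number of ones in a word for which `p` plus the number of preceding zeros is a multiple
of `r`. -/
def alignedOnes (r : ℕ) : ℕ → List Bool → ℕ
  | _, [] => 0
  | p, false :: w => alignedOnes r (p + 1) w
  | p, true :: w => (if r ∣ p then 1 else 0) + alignedOnes r p w

theorem alignedOnes_replicate_false (r p n : ℕ) (w : List Bool) :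
    alignedOnes r p (List.replicate n false ++ w) = alignedOnes r (p + n) w := by
  induction n generalizing p with
  | zero => simp
  | succ n ih =>
    simp only [List.replicate_succ, List.cons_append, alignedOnes, ih]
    congr 1
    omega

theorem alignedOnes_replicate_true (r p n : ℕ) (w : List Bool) :
    alignedOnes r p (List.replicate n true ++ w) =
      (if r ∣ p then n else 0) + alignedOnes r p w := by
  induction n with
  | zero => simp
  | succ n ih =>
    simp only [List.replicate_succ, List.cons_append, alignedOnes, ih]
    split_ifs <;> omega

theorem zeroRunBlocks_succ (r n : ℕ) (a : ℕ → ℕ) :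
    zeroRunBlocks r (n + 1) a = List.replicate r false ++
      (List.replicate (a 0) true ++ zeroRunBlocks r n fun i => a (i + 1)) := by
  simp [zeroRunBlocks, List.range_succ_eq_map, Function.comp_def]

theorem count_false_zeroRunBlocks (r n : ℕ) (a : ℕ → ℕ) :
    (zeroRunBlocks r n a).count false = n * r := by
  induction n generalizing a with
  | zero => simp [zeroRunBlocks]
  | succ n ih =>
    rw [zeroRunBlocks_succ, List.count_append, List.count_append, ih]
    simp [List.count_replicate]
    ring

namespace Interleave

theorem count_add_count {α : Type*} [DecidableEq α] {x y z : List α} (h : Interleave x y z)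
    (c : α) : x.count c + y.count c = z.count c := by
  induction h with
  | nil => simp
  | cons_left a _ ih => simp only [List.count_cons]; omega
  | cons_right a _ ih => simp only [List.count_cons]; omega

theorem exists_of_replicate_append_s1 {α : Type*} (c : α) (n : ℕ) {x y z : List α}
    (h : Interleave x y (List.replicate n c ++ z)) :
    ∃ p q x' y', p + q = n ∧ x = List.replicate p c ++ x' ∧ y = List.replicate q c ++ y' ∧
      Interleave x' y' z := by
  induction n generalizing x y with
  | zero => exact ⟨0, 0, x, y, rfl, rfl, rfl, h⟩
  | succ n ih =>
    rw [List.replicate_succ, List.cons_append] at h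
    cases h with
    | cons_left _ h =>
      obtain ⟨p, q, x', y', hpq, rfl, rfl, h'⟩ := ih h
      exact ⟨p + 1, q, x', y', by omega, rfl, rfl, h'⟩
    | cons_right _ h =>
      obtain ⟨p, q, x', y', hpq, rfl, rfl, h'⟩ := ih h
      exact ⟨p, q + 1, x', y', by omega, rfl, rfl, h'⟩

/-- Removing the first zero-run and the first one-run from an interleaving whose two parts start
at offsets `s` and `t` summing to a multiple of `r`: both parts are aligned, or neither is, at
that one-run. -/
theorem exists_of_zeroRunBlocks_succ {r n : ℕ} {a : ℕ → ℕ} {x y : List Bool} {s t : ℕ}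
    (hst : r ∣ s + t) (h : Interleave x y (zeroRunBlocks r (n + 1) a)) :
    ∃ p q x' y', r ∣ s + p + (t + q) ∧
      Interleave x' y' (zeroRunBlocks r n fun i => a (i + 1)) ∧
      x.count false = p + x'.count false ∧
      alignedOnes r s x + alignedOnes r t y =
        (if r ∣ s + p then a 0 else 0) +
          (alignedOnes r (s + p) x' + alignedOnes r (t + q) y') := by
  rw [zeroRunBlocks_succ] at h
  obtain ⟨p, q, x, y, hpq, rfl, rfl, h₁⟩ := h.exists_of_replicate_append_s1
  obtain ⟨u, v, x, y, huv, rfl, rfl, h₂⟩ := h₁.exists_of_replicate_append_s1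
  have hdvd : r ∣ s + p + (t + q) := by
    rw [show s + p + (t + q) = s + t + r by omega]
    exact hst.add (dvd_refl r)
  have hiff : r ∣ t + q ↔ r ∣ s + p :=
    ⟨fun h => (Nat.dvd_add_iff_left h).2 hdvd, fun h => (Nat.dvd_add_iff_right h).2 hdvd⟩
  refine ⟨p, q, x, y, hdvd, h₂, by simp [List.count_replicate], ?_⟩
  simp only [alignedOnes_replicate_false, alignedOnes_replicate_true, hiff]
  split_ifs <;> omega

/-- If all one-runs but the last are even, then the parity of the total number of aligned ones in
the two parts of an interleaving is decided by the last run. -/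
theorem alignedOnes_add_alignedOnes_mod_two {r n : ℕ} {a : ℕ → ℕ} (ha : ∀ i < n, Even (a i))
    {x y : List Bool} {s t : ℕ} (hst : r ∣ s + t)
    (h : Interleave x y (zeroRunBlocks r (n + 1) a)) :
    (alignedOnes r s x + alignedOnes r t y) % 2 =
      if r ∣ s + x.count false then a n % 2 else 0 := by
  induction n generalizing a x y s t with
  | zero =>
    obtain ⟨p, q, x', y', -, h', hc, hw⟩ := h.exists_of_zeroRunBlocks_succ hst
    obtain ⟨rfl, rfl⟩ : x' = [] ∧ y' = [] := by
      cases h'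
      exact ⟨rfl, rfl⟩
    simp only [hw, hc, alignedOnes, List.count_nil, add_zero]
    split_ifs <;> rfl
  | succ n ih =>
    obtain ⟨p, q, x', y', hdvd, h', hc, hw⟩ := h.exists_of_zeroRunBlocks_succ hst
    have hmod := ih (fun i hi => ha (i + 1) (by omega)) hdvd h'
    have ha0 := Nat.even_iff.1 (ha 0 (by omega))
    rw [hw, hc, ← add_assoc s, ← hmod]
    split_ifs <;> omega

end Interleave

theorem statement1 (r m : ℕ) (hr : 1 ≤ r) (hm : 1 ≤ m) (a : ℕ → ℕ)
    (ha_pos : ∀ i < 2 * m, 0 < a i)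
    (ha0 : Odd (a 0)) (halast : Odd (a (2 * m - 1)))
    (ha_even : ∀ i, 0 < i → i < 2 * m - 1 → Even (a i)) :
    ¬ IsShuffleSquare
      (List.replicate (a 0) true ++
        ((List.range (2 * m - 1)).map fun i =>
          List.replicate r false ++ List.replicate (a (i + 1)) true).flatten) := by
  rintro ⟨x, h⟩
  obtain ⟨n, hn⟩ : ∃ n, 2 * m - 1 = n + 1 := ⟨2 * m - 2, by omega⟩
  change Interleave x x
    (List.replicate (a 0) true ++ zeroRunBlocks r (2 * m - 1) fun i => a (i + 1)) at h
  have hcount := h.count_add_count false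
  rw [List.count_append, count_false_zeroRunBlocks] at hcount
  have hndvd : ¬ r ∣ x.count false := by
    rintro ⟨k, hk⟩
    have : r * (2 * k) = r * (2 * m - 1) := by
      simp [List.count_replicate, hk] at hcount
      linarith
    have := Nat.eq_of_mul_eq_mul_left hr this
    omega
  rw [hn] at h
  obtain ⟨p, q, x', y', hpq, hx, hy, h'⟩ := h.exists_of_replicate_append_s1
  have hmod := h'.alignedOnes_add_alignedOnes_mod_two (s := 0) (t := 0)
    (fun i hi => ha_even (i + 1) (by omega) (by omega)) (by simp)
  have hcx : x.count false = x'.count false := by simp [hx, List.count_replicate]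
  have hwx : alignedOnes r 0 x = p + alignedOnes r 0 x' := by
    simp [hx, alignedOnes_replicate_true]
  have hwy : alignedOnes r 0 x = q + alignedOnes r 0 y' := by
    simp [hy, alignedOnes_replicate_true]
  rw [zero_add, ← hcx, if_neg hndvd] at hmod
  rw [Nat.odd_iff] at ha0
  omega
end

section
/- Let a, b, c, d be positive integers, not all even, such that a + c and b + d are both even. Then the binary word W = 1^a 0^b 1^c 0^d is a shuffle square if and only if a ≥ c and b ≤ d. -/
namespace Interleave

variable {α : Type*}

theorem append {x y z x' y' z' : List α} (h : Interleave x y z) (h' : Interleave x' y' z') :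
    Interleave (x ++ x') (y ++ y') (z ++ z') := by
  induction h with
  | nil => exact h'
  | cons_left a _ ih => exact .cons_left a ih
  | cons_right a _ ih => exact .cons_right a ih

theorem exists_of_append {x y u v : List α} (h : Interleave x y (u ++ v)) :
    ∃ x₁ x₂ y₁ y₂, x = x₁ ++ x₂ ∧ y = y₁ ++ y₂ ∧ Interleave x₁ y₁ u ∧ Interleave x₂ y₂ v := by
  induction u generalizing x y with
  | nil => exact ⟨[], x, [], y, rfl, rfl, .nil, h⟩
  | cons a u ih =>
    cases h with
    | cons_left _ h =>
      obtain ⟨x₁, x₂, y₁, y₂, rfl, rfl, h₁, h₂⟩ := ih h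
      exact ⟨a :: x₁, x₂, y₁, y₂, rfl, rfl, .cons_left a h₁, h₂⟩
    | cons_right _ h =>
      obtain ⟨x₁, x₂, y₁, y₂, rfl, rfl, h₁, h₂⟩ := ih h
      exact ⟨x₁, x₂, a :: y₁, y₂, rfl, rfl, .cons_right a h₁, h₂⟩

theorem replicate (a : α) (p q : ℕ) :
    Interleave (List.replicate p a) (List.replicate q a) (List.replicate (p + q) a) := by
  induction p with
  | zero =>
    induction q with
    | zero => exact .nil
    | succ q ih => exact .cons_right a ih
  | succ p ih =>
    rw [Nat.add_right_comm]
    exact .cons_left a ih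

theorem exists_of_replicate {a : α} {n : ℕ} {x y : List α}
    (h : Interleave x y (List.replicate n a)) :
    ∃ p q, p + q = n ∧ x = List.replicate p a ∧ y = List.replicate q a := by
  induction n generalizing x y with
  | zero => cases h; exact ⟨0, 0, rfl, rfl, rfl⟩
  | succ n ih =>
    cases h with
    | cons_left _ h =>
      obtain ⟨p, q, rfl, rfl, rfl⟩ := ih h
      exact ⟨p + 1, q, by omega, rfl, rfl⟩
    | cons_right _ h =>
      obtain ⟨p, q, rfl, rfl, rfl⟩ := ih h
      exact ⟨p, q + 1, by omega, rfl, rfl⟩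

end Interleave

theorem List.replicate_append_inj_of_head? {α : Type*} {a : α} {p q : ℕ} {u v : List α}
    (hu : u.head? ≠ some a) (hv : v.head? ≠ some a)
    (h : List.replicate p a ++ u = List.replicate q a ++ v) : p = q ∧ u = v := by
  induction p generalizing q with
  | zero =>
    cases q with
    | zero => simpa using h
    | succ q => simp [List.replicate_succ] at h; simp [h] at hu
  | succ p ih =>
    cases q with
    | zero => simp [List.replicate_succ] at h; simp [← h] at hv
    | succ q =>
      simp only [List.replicate_succ, List.cons_append, List.cons.injEq, true_and] at h
      simpa using ih h

theorem add_eq_of_replicate_append_eq {p r s p' q' r' s' : ℕ} (hq' : 0 < q')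
    (h : List.replicate p true ++ List.replicate 0 false ++ List.replicate r true ++
        List.replicate s false =
      List.replicate p' true ++ List.replicate q' false ++ List.replicate r' true ++
        List.replicate s' false) : p + r = p' := by
  obtain ⟨k, rfl⟩ := Nat.exists_eq_succ_of_ne_zero hq'.ne'
  simp only [List.replicate_zero, List.append_nil, List.replicate_append_replicate] at h
  rw [List.append_assoc, List.append_assoc] at h
  refine (List.replicate_append_inj_of_head? ?_ ?_ h).1
  · cases s <;> simp [List.replicate_succ]
  · simp [List.replicate_succ]

theorem replicate_append_inj {p q r s p' q' r' s' : ℕ} (hq : 0 < q) (hq' : 0 < q')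
    (hr : 0 < r + r')
    (h : List.replicate p true ++ List.replicate q false ++ List.replicate r true ++
        List.replicate s false =
      List.replicate p' true ++ List.replicate q' false ++ List.replicate r' true ++
        List.replicate s' false) : p = p' ∧ q = q' ∧ r = r' ∧ s = s' := by
  have ht := congrArg (List.count true) h
  have hf := congrArg (List.count false) h
  simp [List.count_replicate] at ht hf
  obtain ⟨k, rfl⟩ := Nat.exists_eq_succ_of_ne_zero hq.ne'
  obtain ⟨k', rfl⟩ := Nat.exists_eq_succ_of_ne_zero hq'.ne'
  simp only [List.append_assoc] at h
  obtain ⟨hp, h⟩ := List.replicate_append_inj_of_head?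
    (by simp [List.replicate_succ]) (by simp [List.replicate_succ]) h
  obtain ⟨m, rfl⟩ := Nat.exists_eq_succ_of_ne_zero (show r ≠ 0 by omega)
  obtain ⟨m', rfl⟩ := Nat.exists_eq_succ_of_ne_zero (show r' ≠ 0 by omega)
  have hk := (List.replicate_append_inj_of_head?
    (by simp [List.replicate_succ]) (by simp [List.replicate_succ]) h).1
  omega

theorem statement3 (a b c d : ℕ) (ha : 0 < a) (hb : 0 < b) (hc : 0 < c) (hd : 0 < d)
    (hnotall : ¬ (Even a ∧ Even b ∧ Even c ∧ Even d))
    (hac : Even (a + c)) (hbd : Even (b + d)) :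
    IsShuffleSquare
        (List.replicate a true ++ List.replicate b false ++
          List.replicate c true ++ List.replicate d false) ↔
      c ≤ a ∧ b ≤ d := by
  constructor
  · rintro ⟨x, h⟩
    obtain ⟨x₃, w₁, y₃, w₂, hx, hy, h, h₄⟩ := h.exists_of_append
    obtain ⟨x₂, w₃, y₂, w₄, rfl, rfl, h, h₃⟩ := h.exists_of_append
    obtain ⟨x₁, w₅, y₁, w₆, rfl, rfl, h₁, h₂⟩ := h.exists_of_append
    obtain ⟨p, p', rfl, rfl, rfl⟩ := h₁.exists_of_replicate
    obtain ⟨q, q', rfl, rfl, rfl⟩ := h₂.exists_of_replicate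
    obtain ⟨r, r', rfl, rfl, rfl⟩ := h₃.exists_of_replicate
    obtain ⟨s, s', rfl, rfl, rfl⟩ := h₄.exists_of_replicate
    have h := hx.symm.trans hy
    have ht := congrArg (List.count true) h
    have hf := congrArg (List.count false) h
    simp [List.count_replicate] at ht hf
    rcases Nat.eq_zero_or_pos q with rfl | hq
    · have := add_eq_of_replicate_append_eq (by omega) h
      omega
    rcases Nat.eq_zero_or_pos q' with rfl | hq'
    · have := add_eq_of_replicate_append_eq hq h.symm
      omega
    obtain ⟨rfl, rfl, rfl, rfl⟩ := replicate_append_inj hq hq' hc h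
    exact absurd ⟨⟨p, rfl⟩, ⟨q, rfl⟩, ⟨r, rfl⟩, ⟨s, rfl⟩⟩ hnotall
  · rintro ⟨hca, hbd'⟩
    obtain ⟨m, rfl⟩ : ∃ m, a = m + c + m := by
      obtain ⟨k, hk⟩ := hac
      exact ⟨k - c, by omega⟩
    obtain ⟨n, rfl⟩ : ∃ n, d = n + (b + n) := by
      obtain ⟨k, hk⟩ := hbd
      exact ⟨k - b, by omega⟩
    have h := (((Interleave.replicate true (m + c) m).append
      (Interleave.replicate false b 0)).append
      (Interleave.replicate true 0 c)).append (Interleave.replicate false n (b + n))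
    refine ⟨List.replicate (m + c) true ++ List.replicate (b + n) false, ?_⟩
    simpa [← List.replicate_append_replicate] using h
end

section
/- Let H be a graph on the vertex set {1, 2, …, n} that is the union of two vertex-disjoint subgraphs: a path P whose endpoints are the vertices 1 and n, and a cycle C. If H, viewed as an ordered graph with the natural linear order on {1,…,n}, is nest-free, then C is an even cycle (its number of vertices is even). -/
namespace SimpleGraph.Walk

variable {n : ℕ} {H : SimpleGraph (Fin n)}

/-- Draw a nest-free graph on a cylinder, every edge winding once around from its smaller to its
larger endpoint. This is the parity of the sum, over the edges of the walk passing over `z`, of the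
heights of their smaller endpoints in the universal cover, measured from the end of the walk. -/
def crossingParity (z : Fin n) : {u v : Fin n} → H.Walk u v → ZMod 2
  | _, _, nil => 0
  | u, _, cons (v := w) _ p => crossingParity z p +
      (if u < z ∧ z < w then (p.length : ZMod 2)
        else if w < z ∧ z < u then (p.length : ZMod 2) + 1 else 0)

/-- A walk avoiding `a` and `b` and ending to the right of `b` crosses over the endpoints of an
edge `{a, b}` with parities whose sum depends only on the start of the walk and its length. -/
theorem crossingParity_add_crossingParity
    (hnest : ∀ a b c d : Fin n,
      H.Adj a b → H.Adj c d → a < c → c < d → d < b → False)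
    {a b : Fin n} (hab : H.Adj a b) (hlt : a < b) {u v : Fin n} (p : H.Walk u v)
    (hv : b < v) (ha : a ∉ p.support) (hb : b ∉ p.support) :
    crossingParity a p + crossingParity b p =
      if u < a then 1 else if u < b then (p.length : ZMod 2) + 1 else 0 := by
  induction p with
  | nil =>
    simp [crossingParity, not_lt.2 hv.le, not_lt.2 (hlt.trans hv).le]
  | @cons u w v h p ih =>
    simp only [support_cons, List.mem_cons, not_or] at ha hb
    replace ih := ih hv ha.2 hb.2
    have hwa : w ≠ a := fun e => ha.2 (e ▸ p.start_mem_support)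
    have hwb : w ≠ b := fun e => hb.2 (e ▸ p.start_mem_support)
    have hua : u ≠ a := Ne.symm ha.1
    have hub : u ≠ b := Ne.symm hb.1
    have h1 : ¬ (a < u ∧ u < w ∧ w < b) := fun e => hnest a b u w hab h e.1 e.2.1 e.2.2
    have h3 : ¬ (a < w ∧ w < u ∧ u < b) := fun e => hnest a b w u hab h.symm e.1 e.2.1 e.2.2
    have h4 : ¬ (u < a ∧ b < w) := fun e => hnest u w a b h hab e.1 hlt e.2
    have h5 : ¬ (w < a ∧ b < u) := fun e => hnest w u a b h.symm hab e.1 hlt e.2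
    have h6 : u ≠ w := h.ne
    simp only [crossingParity, length_cons, Nat.cast_add, Nat.cast_one]
    generalize crossingParity a p = α at *
    generalize crossingParity b p = β at *
    generalize (p.length : ZMod 2) = l at *
    split_ifs at ih ⊢ <;> first | (exfalso; omega) | (revert ih α β l; decide)

/-- If a function to `ZMod 2` separates the endpoints of every edge of a walk, the parity of the
length of the walk is the sum of the values at its ends. -/
theorem natCast_length_eq_add {V : Type*} {G : SimpleGraph V} (c : V → ZMod 2) {x y : V}
    (q : G.Walk x y) (hq : ∀ a b, s(a, b) ∈ q.edges → c a + c b = 1) :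
    (q.length : ZMod 2) = c x + c y := by
  have h2 : (2 : ZMod 2) = 0 := rfl
  induction q with
  | nil => simp [CharTwo.add_self_eq_zero]
  | @cons x w y h q ih =>
    have hxw := hq x w (by simp)
    have ih := ih fun a b hab => hq a b (by simp [hab])
    rw [length_cons, Nat.cast_add, ih, Nat.cast_one]
    linear_combination (c w) * h2 - hxw

end SimpleGraph.Walk

/-- Let `H` be a graph on the linearly ordered vertex set `Fin n` (representing `{1,…,n}`)
which is the union of two vertex-disjoint subgraphs: a path `P` whose endpoints are the
first and the last vertex, and a cycle `C`.  If `H` is nest-free as an ordered graph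
(there are no edges `{a,b}`, `{c,d}` with `a < c`, `c < d` and `d < b`), then the cycle
`C` is even. -/
theorem statement8 (n : ℕ) (hn : 0 < n) (H : SimpleGraph (Fin n))
    (u v : Fin n) (hu : (u : ℕ) = 0) (hv : (v : ℕ) = n - 1)
    (P : H.Walk u v) (hP : P.IsPath)
    (x : Fin n) (C : H.Walk x x) (hC : C.IsCycle)
    (hdisj : ∀ z : Fin n, z ∈ P.support → z ∈ C.support → False)
    (hcoverV : ∀ z : Fin n, z ∈ P.support ∨ z ∈ C.support)
    (hcoverE : ∀ e ∈ H.edgeSet, e ∈ P.edges ∨ e ∈ C.edges)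
    (hnestfree : ∀ a b c d : Fin n,
      H.Adj a b → H.Adj c d → a < c → c < d → d < b → False) :
    Even C.length := by
  have key : ∀ a b : Fin n, a < b → s(a, b) ∈ C.edges →
      P.crossingParity a + P.crossingParity b = 1 := by
    intro a b hlt hab
    have haC := C.fst_mem_support_of_mem_edges hab
    have hbC := C.snd_mem_support_of_mem_edges hab
    have hua : u ≠ a := fun e => hdisj a (e ▸ P.start_mem_support) haC
    have hvb : v ≠ b := fun e => hdisj b (e ▸ P.end_mem_support) hbC
    rw [P.crossingParity_add_crossingParity hnestfree (C.adj_of_mem_edges hab) hlt (by omega)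
      (fun h => hdisj a h haC) (fun h => hdisj b h hbC), if_pos (by omega)]
  have hlen := C.natCast_length_eq_add (fun z => P.crossingParity z) fun a b hab => by
    rcases lt_or_gt_of_ne (C.adj_of_mem_edges hab).ne with hlt | hlt
    · exact key a b hlt hab
    · rw [add_comm]
      exact key b a hlt (Sym2.eq_swap ▸ hab)
  rwa [CharTwo.add_self_eq_zero, ZMod.natCast_eq_zero_iff_even] at hlen
end

section
/- Let r ≥ 1 and let n_1, n_2, …, n_r be positive integers such that n_1 is odd and n_2 > n_3 > ⋯ > n_r is a strictly decreasing sequence. Then the binary word W(n_1,…,n_r) = U_1 U_2 ⋯ U_r, whose i-th run U_i has length n_i, where U_1 is a 1-run and the runs alternate between 1-runs and 0-runs, is not a shuffle square. -/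
/-- `altWord [n₁, …, n_r] b` is the binary word consisting of `r` alternating runs of
lengths `n₁, …, n_r`, the first run consisting of the letter `b`. -/
def altWord : List ℕ → Bool → List Bool
  | [], _ => []
  | n :: ns, b => List.replicate n b ++ altWord ns (!b)

/-- `Drains q w` means that reading `w` letter by letter, either appending the letter to the end
of the queue or deleting it from the front, can turn the queue `q` into the empty queue. -/
def Drains {α : Type*} : List α → List α → Prop
  | q, [] => q = []
  | q, a :: w => Drains (q ++ [a]) w ∨ ∃ q', q = a :: q' ∧ Drains q' w

theorem Interleave.symm {α : Type*} {x y z : List α} (h : Interleave x y z) :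
    Interleave y x z := by
  induction h with
  | nil => exact .nil
  | cons_left a _ ih => exact .cons_right a ih
  | cons_right a _ ih => exact .cons_left a ih

theorem Interleave.drains {α : Type*} {w q y : List α} (h : Interleave (q ++ y) y w) :
    Drains q w := by
  induction w generalizing q y with
  | nil =>
    generalize hx : q ++ y = x at h
    cases h
    exact (List.append_eq_nil_iff.mp hx).1
  | cons a w ih =>
    generalize hx : q ++ y = x at h
    cases h with
    | cons_left _ h =>
      cases q with
      | nil =>
        obtain rfl : y = _ := hx
        exact Or.inl (ih (q := [a]) h.symm)
      | cons b q =>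
        obtain ⟨rfl, rfl⟩ := List.cons_eq_cons.mp hx
        exact Or.inr ⟨q, rfl, ih h⟩
    | @cons_right _ _ ys _ h =>
      subst hx
      exact Or.inl (ih (y := ys) (by simpa using h))

theorem IsShuffleSquare.drains {α : Type*} {w : List α} (h : IsShuffleSquare w) :
    Drains [] w :=
  let ⟨_, hx⟩ := h
  Interleave.drains (q := []) hx

/-- A queue containing a block of `m` equal letters either starts with `m` letters `v`, or the
block survives the deletion of all leading letters `v`. -/
theorem exists_eq_replicate_append_of_replicate_infix {v c : Bool} {m : ℕ} (hm : 0 < m)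
    {q : List Bool} (h : List.replicate m c <:+: q) :
    (∃ y, q = List.replicate m v ++ y) ∨
      ∃ i t, q = List.replicate i v ++ (!v) :: t ∧ List.replicate m c <:+: (!v) :: t := by
  induction q with
  | nil => simp [hm.ne'] at h
  | cons a q ih =>
    by_cases ha : a = v
    · subst ha
      rcases List.infix_cons_iff.mp h with h | h
      · obtain ⟨n, rfl⟩ := Nat.exists_eq_add_one.mpr hm
        obtain ⟨y, hy⟩ := h
        obtain rfl : c = a := by
          rw [List.replicate_succ, List.cons_append] at hy
          exact (List.cons_eq_cons.mp hy).1
        exact Or.inl ⟨y, hy.symm⟩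
      · rcases ih h with ⟨y, rfl⟩ | ⟨i, t, rfl, ht⟩
        · refine Or.inl ⟨a :: y, ?_⟩
          rw [← List.cons_append, ← List.replicate_succ, List.replicate_succ']
          simp
        · exact Or.inr ⟨i + 1, t, by simp [List.replicate_succ], ht⟩
    · obtain rfl : a = !v := by
        revert ha; cases a <;> cases v <;> simp
      exact Or.inr ⟨0, q, rfl, h⟩

/-- The possible queues while reading a run of `p` letters `v`, `k` of which are still to come. -/
def QueueState (p : ℕ) (v : Bool) (k : ℕ) (q : List Bool) : Prop :=
  (∃ y, q = List.replicate (k + 1) v ++ y) ∨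
  (∃ i t c, q = List.replicate i v ++ (!v) :: t ∧ List.replicate p c <:+: (!v) :: t) ∨
  (∃ t, q = (!v) :: t ++ List.replicate (p - k) v)

theorem QueueState.exists_drains {p k : ℕ} {v : Bool} {q w : List Bool} (hk : k ≤ p)
    (hq : QueueState p v k q) (h : Drains q (List.replicate k v ++ w)) :
    ∃ q', QueueState p v 0 q' ∧ Drains q' w := by
  induction k generalizing q with
  | zero => exact ⟨q, hq, h⟩
  | succ k ih =>
    rcases h with h | ⟨q', rfl, h⟩ <;> refine ih (by omega) ?_ h
    · rcases hq with ⟨y, rfl⟩ | ⟨i, t, c, rfl, ht⟩ | ⟨t, rfl⟩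
      · refine Or.inl ⟨v :: y ++ [v], ?_⟩
        rw [List.replicate_succ']
        simp
      · refine Or.inr (Or.inl ⟨i, t ++ [v], c, by simp, ?_⟩)
        exact ht.trans ⟨[], [v], by simp⟩
      · refine Or.inr (Or.inr ⟨t, ?_⟩)
        rw [show p - k = p - (k + 1) + 1 by omega, List.replicate_succ']
        simp
    · rcases hq with ⟨y, hy⟩ | ⟨i, t, c, hy, ht⟩ | ⟨t, hy⟩
      · exact Or.inl ⟨y, by simpa [List.replicate_succ] using hy⟩
      · cases i with
        | zero => simp at hy
        | succ i =>
          exact Or.inr (Or.inl ⟨i, t, c, by simpa [List.replicate_succ] using hy, ht⟩)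
      · simp at hy

theorem not_drains_altWord {N : ℕ} {ns : List ℕ} {v a : Bool} {q : List Bool}
    (hN : ∀ k ∈ ns, k < N) (hdec : ns.Pairwise (· > ·))
    (hq : a ≠ v ∨ ∃ c, List.replicate N c <:+: a :: q) :
    ¬ Drains (a :: q) (altWord ns v) := by
  induction ns generalizing N v a q with
  | nil => simp [altWord, Drains]
  | cons p ns ih =>
    intro h
    have hp : p < N := hN p (by simp)
    obtain ⟨hps, hdec⟩ := List.pairwise_cons.mp hdec
    have hstate : QueueState p v p (a :: q) := by
      by_cases ha : a = v
      · obtain ⟨c, hc⟩ := hq.resolve_left (not_not.mpr ha)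
        have hc' : List.replicate (p + 1) c <:+: a :: q := by
          refine List.IsInfix.trans ⟨[], List.replicate (N - (p + 1)) c, ?_⟩ hc
          rw [List.nil_append, List.replicate_append_replicate]
          congr 1
          omega
        rcases exists_eq_replicate_append_of_replicate_infix (v := v) p.succ_pos hc' with
          hy | ⟨i, t, hy, ht⟩
        · exact Or.inl hy
        · refine Or.inr (Or.inl ⟨i, t, c, hy, List.IsInfix.trans ⟨[], [c], ?_⟩ ht⟩)
          rw [List.replicate_succ']
          simp
      · obtain rfl : a = !v := by
          revert ha; cases a <;> cases v <;> simp
        exact Or.inr (Or.inr ⟨q, by simp⟩)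
    obtain ⟨q', hq', h⟩ := hstate.exists_drains le_rfl h
    rcases hq' with ⟨y, rfl⟩ | ⟨i, t, c, rfl, ht⟩ | ⟨t, rfl⟩
    · exact ih (a := v) (q := y) hps hdec (Or.inl (by simp)) h
    · cases i with
      | zero => exact ih hps hdec (Or.inr ⟨c, ht⟩) h
      | succ i =>
        exact ih (a := v) (q := List.replicate i v ++ (!v) :: t) hps hdec (Or.inl (by simp)) h
    · refine ih (a := !v) (q := t ++ List.replicate p v) hps hdec (Or.inr ⟨v, ?_⟩) h
      exact ⟨(!v) :: t, [], by simp⟩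

theorem Drains.exists_of_replicate {α : Type*} {v : α} {n i : ℕ} {w : List α}
    (hodd : Odd (i + n)) (h : Drains (List.replicate i v) (List.replicate n v ++ w)) :
    ∃ j, Drains (v :: List.replicate j v) w := by
  induction n generalizing i with
  | zero =>
    obtain ⟨j, rfl⟩ := Nat.exists_eq_add_one.mpr hodd.pos
    exact ⟨j, h⟩
  | succ n ih =>
    rcases h with h | ⟨q', hq, h⟩
    · rw [← List.replicate_succ'] at h
      exact ih (by convert hodd using 1; omega) h
    · cases i with
      | zero => simp at hq
      | succ i =>
        obtain rfl : List.replicate i v = q' := (List.cons_eq_cons.mp hq).2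
        refine ih ?_ h
        rw [Nat.odd_iff] at hodd ⊢
        omega

/-- If `n₁` is odd and `n₂ > n₃ > ⋯ > n_r` is strictly decreasing (all `nᵢ` positive),
then the word `W(n₁,…,n_r)`, whose `i`-th run has length `nᵢ` with the first run a
`1`-run, is not a shuffle square. -/
theorem statement9 (n₁ : ℕ) (ns : List ℕ) (h₁ : Odd n₁)
    (hpos : ∀ k ∈ n₁ :: ns, 0 < k)
    (hdec : List.Chain' (· > ·) ns) :
    ¬ IsShuffleSquare (altWord (n₁ :: ns) true) := by
  intro h
  obtain ⟨j, hj⟩ := Drains.exists_of_replicate (i := 0) (by simpa using h₁) h.drains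
  refine not_drains_altWord (N := ns.sum + 1) (fun k hk => ?_) (List.isChain_iff_pairwise.mp hdec)
    (Or.inl (by simp)) hj
  exact Nat.lt_succ_of_le (List.le_sum_of_mem hk)
end

section
/- Let m be an odd positive integer and let r be a positive integer with m ≥ 2r − 1. Let O_{m,r} = W(m, m−2, m−4, …, m−2r+2) be the binary word with r alternating runs (starting with a 1-run) whose lengths are the consecutive odd numbers m, m−2, …, m−2r+2; its length is r(m−r+1). Then O_{m,r} contains a pair of twins whose double length is at least r(m−r+1) − 23; equivalently, one can delete at most 23 letters from O_{m,r} to obtain a shuffle square. -/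
/-- `HasTwins w t` says that `w` contains a pair of twins of length `t`: two strictly
increasing sequences of positions with disjoint supports along which `w` spells the same
word. -/
def HasTwins {α : Type*} (w : List α) (t : ℕ) : Prop :=
  ∃ i j : Fin t → Fin w.length, StrictMono i ∧ StrictMono j ∧
    (∀ h h', i h ≠ j h') ∧ (∀ h, w.get (i h) = w.get (j h))

/-- `DisjointSublists w u v` says that `u` and `v` are subsequences of `w` with disjoint
supports. -/
inductive DisjointSublists {α : Type*} : List α → List α → List α → Prop
  | nil : DisjointSublists [] [] []
  | skip (x : α) {w u v : List α} : DisjointSublists w u v → DisjointSublists (x :: w) u v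
  | left (x : α) {w u v : List α} :
      DisjointSublists w u v → DisjointSublists (x :: w) (x :: u) v
  | right (x : α) {w u v : List α} :
      DisjointSublists w u v → DisjointSublists (x :: w) u (x :: v)

namespace DisjointSublists

variable {α : Type*}

theorem append {w u v w' u' v' : List α} (h : DisjointSublists w u v)
    (h' : DisjointSublists w' u' v') :
    DisjointSublists (w ++ w') (u ++ u') (v ++ v') := by
  induction h with
  | nil => exact h'
  | skip x _ ih => exact ih.skip x
  | left x _ ih => exact ih.left x
  | right x _ ih => exact ih.right x

theorem sublist_left {w u v u' : List α} (h : DisjointSublists w u v) (hu : u'.Sublist u) :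
    DisjointSublists w u' v := by
  induction h generalizing u' with
  | nil => rw [List.sublist_nil.mp hu]; exact .nil
  | skip x _ ih => exact (ih hu).skip x
  | left x _ ih =>
    cases hu with
    | cons _ hu => exact (ih hu).skip x
    | cons_cons _ hu => exact (ih hu).left x
  | right x _ ih => exact (ih hu).right x

theorem replicate (b : α) (f c d : ℕ) :
    DisjointSublists (List.replicate (f + c + d) b) (List.replicate f b)
      (List.replicate c b) := by
  induction f with
  | succ f ih =>
    rw [show f + 1 + c + d = f + c + d + 1 by omega]
    exact ih.left b
  | zero =>
    induction c with
    | succ c ih =>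
      rw [show 0 + (c + 1) + d = 0 + c + d + 1 by omega]
      exact ih.right b
    | zero =>
      induction d with
      | zero => exact .nil
      | succ d ih => exact ih.skip b

theorem exists_positions {w u v : List α} (h : DisjointSublists w u v) :
    ∃ i j : ℕ → ℕ,
      (∀ a b, a < b → b < u.length → i a < i b) ∧
      (∀ a b, a < b → b < v.length → j a < j b) ∧
      (∀ a b, a < u.length → b < v.length → i a ≠ j b) ∧
      (∀ a, a < u.length → w[i a]? = u[a]?) ∧ (∀ a, a < v.length → w[j a]? = v[a]?) := by
  induction h with
  | nil => exact ⟨id, id, by simp⟩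
  | skip x _ ih =>
    obtain ⟨i, j, hi, hj, hij, hu, hv⟩ := ih
    refine ⟨fun a => i a + 1, fun a => j a + 1, ?_, ?_, ?_, ?_, ?_⟩ <;> grind
  | left x _ ih =>
    obtain ⟨i, j, hi, hj, hij, hu, hv⟩ := ih
    refine ⟨fun | 0 => 0 | a + 1 => i a + 1, fun a => j a + 1, ?_, ?_, ?_, ?_, ?_⟩
    · rintro (_ | a) (_ | b) hab hb
      all_goals simp_all
    · grind
    · rintro (_ | a) b ha hb
      all_goals simp_all
    · rintro (_ | a) ha
      all_goals simp_all
    · grind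
  | right x _ ih =>
    obtain ⟨i, j, hi, hj, hij, hu, hv⟩ := ih
    refine ⟨fun a => i a + 1, fun | 0 => 0 | a + 1 => j a + 1, ?_, ?_, ?_, ?_, ?_⟩
    · grind
    · rintro (_ | a) (_ | b) hab hb
      all_goals simp_all
    · rintro a (_ | b) ha hb
      all_goals simp_all
    · grind
    · rintro (_ | a) ha
      all_goals simp_all

theorem hasTwins {w u : List α} (h : DisjointSublists w u u) : HasTwins w u.length := by
  obtain ⟨i, j, hi, hj, hij, hu, hv⟩ := h.exists_positions
  have lt_of_get {k : ℕ → ℕ} (hk : ∀ a, a < u.length → w[k a]? = u[a]?) (a : Fin u.length) :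
      k a < w.length := by
    have := hk a a.2
    grind
  refine ⟨fun a => ⟨i a, lt_of_get hu a⟩, fun a => ⟨j a, lt_of_get hv a⟩,
    fun a b hab => hi a b hab b.2, fun a b hab => hj a b hab b.2, ?_, ?_⟩
  · intro a b hab
    exact hij a b a.2 b.2 (by simpa using hab)
  · intro a
    have h₁ := hu a a.2
    have h₂ := hv a a.2
    grind

end DisjointSublists

/-- `TwinsUpTo w q d` says that, after deleting at most `d` letters, `w` is an interleaving of
some word `v` and of `v ++ q`: all letters of `w` are matched except for the pending queue
`q`. -/
def TwinsUpTo {α : Type*} (w q : List α) (d : ℕ) : Prop :=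
  ∃ v : List α, DisjointSublists w (v ++ q) v ∧ w.length ≤ 2 * v.length + q.length + d

namespace TwinsUpTo

variable {α : Type*}

theorem nil : TwinsUpTo ([] : List α) [] 0 := ⟨[], .nil, by simp⟩

theorem mono {w q : List α} {d d' : ℕ} (h : TwinsUpTo w q d) (hd : d ≤ d') :
    TwinsUpTo w q d' := by
  obtain ⟨v, hv, hl⟩ := h
  exact ⟨v, hv, by omega⟩

theorem drop_queue {w q : List α} {d : ℕ} (h : TwinsUpTo w q d) :
    TwinsUpTo w [] (d + q.length) := by
  obtain ⟨v, hv, hl⟩ := h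
  refine ⟨v, hv.sublist_left (by simp), ?_⟩
  simp only [List.length_nil]
  omega

/-- Read a run of the letter `b`: put `f` letters at the back of the queue, match `c` letters
with the front of the queue, and delete `e` letters. -/
theorem append_run {w q q' : List α} {d n : ℕ} (h : TwinsUpTo w q d) (b : α) (f c e : ℕ)
    (hn : n = f + c + e)
    (hq : q ++ List.replicate f b = List.replicate c b ++ q') :
    TwinsUpTo (w ++ List.replicate n b) q' (d + e) := by
  obtain ⟨v, hv, hl⟩ := h
  subst hn
  refine ⟨v ++ List.replicate c b, ?_, ?_⟩
  · have := hv.append (DisjointSublists.replicate b f c e)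
    rwa [List.append_assoc, hq, ← List.append_assoc] at this
  · have := congrArg List.length hq
    simp only [List.length_append, List.length_replicate] at this ⊢
    omega

theorem append_altWord {w : List Bool} {d : ℕ} (h : TwinsUpTo w [] d) (l : List ℕ) (b : Bool) :
    TwinsUpTo (w ++ altWord l b) [] (d + l.length) := by
  induction l generalizing w d b with
  | nil => simpa [altWord] using h
  | cons n l ih =>
    have := ih (h.append_run (n := n) (q' := []) b (n / 2) (n / 2) (n % 2) (by omega) (by simp))
      (!b)
    rw [altWord, ← List.append_assoc]
    exact this.mono (by simp only [List.length_cons]; omega)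

end TwinsUpTo

/-- The lengths `n, n - 2, …` of `r` consecutive runs. -/
def descLengths (n r : ℕ) : List ℕ := (List.range r).map fun k => n - 2 * k

theorem descLengths_succ (n r : ℕ) : descLengths n (r + 1) = n :: descLengths (n - 2) r := by
  simp only [descLengths, List.range_succ_eq_map, List.map_cons, List.map_map]
  congr 1
  refine List.map_congr_left fun k _ => ?_
  simp only [Function.comp_apply]
  omega

theorem length_descLengths (n r : ℕ) : (descLengths n r).length = r := by
  simp [descLengths]

theorem length_altWord (l : List ℕ) (b : Bool) : (altWord l b).length = l.sum := by
  induction l generalizing b with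
  | nil => rfl
  | cons n l ih => simp [altWord, ih]

theorem sum_descLengths (n r : ℕ) (h : 2 * r ≤ n + 1) :
    (descLengths n r).sum = r * (n - r + 1) := by
  induction r generalizing n with
  | zero => simp [descLengths]
  | succ r ih =>
    rw [descLengths_succ, List.sum_cons]
    rcases Nat.eq_zero_or_pos r with rfl | hr
    · simp only [descLengths, List.range_zero, List.map_nil, List.sum_nil]
      omega
    · rw [ih (n - 2) (by omega)]
      obtain ⟨p, rfl⟩ : ∃ p, n = r + 1 + p := ⟨n - (r + 1), by omega⟩
      rw [show r + 1 + p - 2 - r + 1 = p by omega, show r + 1 + p - (r + 1) + 1 = p + 1 by omega]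
      ring

/-- Eight runs of lengths `n, n - 2, …, n - 14` can be read without any deletion, between two
states in which the queue is a block of `1`s. -/
theorem TwinsUpTo.append_eight_runs {w : List Bool} {n r y d : ℕ}
    (h : TwinsUpTo w (List.replicate y true) d) (hn : 15 ≤ n)
    (hy : y ≤ n + 9) (hpar : Even (y + n + 9)) :
    ∃ w', w' ++ altWord (descLengths (n - 16) r) true =
        w ++ altWord (descLengths n (r + 8)) true ∧
      TwinsUpTo w' (List.replicate (n - 7) true) d := by
  obtain ⟨c, hc⟩ := hpar
  obtain ⟨k, rfl⟩ := Nat.exists_eq_add_of_le' hn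
  have h₁ := h.append_run (n := k + 15) (q' := List.replicate 9 true) true (k + 24 - c) (c - 9) 0
    (by omega) (by simp only [← List.replicate_add]; congr 1; omega)
  have h₂ := h₁.append_run (n := k + 13)
    (q' := List.replicate 9 true ++ List.replicate (k + 13) false) false (k + 13) 0 0
    (by omega) (by simp)
  have h₃ := h₂.append_run (n := k + 11)
    (q' := List.replicate (k + 13) false ++ List.replicate (k + 2) true) true (k + 2) 9 0
    (by omega) (by simp)
  have h₄ := h₃.append_run (n := k + 9)
    (q' := List.replicate (k + 5) false ++ List.replicate (k + 2) true ++
      List.replicate (k + 1) false) false (k + 1) 8 0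
    (by omega) (by
      rw [show k + 13 = 8 + (k + 5) by omega, List.replicate_add 8]
      simp only [List.append_assoc])
  have h₅ := h₄.append_run (n := k + 7)
    (q' := List.replicate (k + 5) false ++ List.replicate (k + 2) true ++
      List.replicate (k + 1) false ++ List.replicate (k + 7) true) true (k + 7) 0 0
    (by omega) (by simp)
  have h₆ := h₅.append_run (n := k + 5)
    (q' := List.replicate (k + 2) true ++ List.replicate (k + 1) false ++
      List.replicate (k + 7) true) false 0 (k + 5) 0
    (by omega) (by simp)
  have h₇ := h₆.append_run (n := k + 3)
    (q' := List.replicate (k + 1) false ++ List.replicate (k + 8) true) true 1 (k + 2) 0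
    (by omega) (by rw [List.replicate_add (k + 7) 1 true]; simp)
  have h₈ := h₇.append_run (n := k + 1) (q' := List.replicate (k + 8) true) false 0 (k + 1) 0
    (by omega) (by simp)
  refine ⟨_, ?_, h₈⟩
  simp only [descLengths_succ, altWord, List.append_assoc, Bool.not_true, Bool.not_false,
    Nat.reduceSubDiff]

theorem TwinsUpTo.append_descLengths {w : List Bool} {n r y : ℕ}
    (h : TwinsUpTo w (List.replicate y true) 0) (hr : 1 ≤ r) (hn : 2 * r ≤ n + 1)
    (hy : y ≤ n + 9) (hyn : 9 ≤ y + n) (hpar : Even (y + n + 9)) :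
    TwinsUpTo (w ++ altWord (descLengths n r) true) [] 16 := by
  induction r using Nat.strong_induction_on generalizing w n y with
  | _ r ih =>
    obtain hr8 | hr8 := Nat.lt_or_ge 8 r
    · obtain ⟨s, rfl⟩ := Nat.exists_eq_add_of_le' hr8.le
      obtain ⟨w', hw, h'⟩ := h.append_eight_runs (r := s) (by omega) hy hpar
      rw [← hw]
      exact ih s (by omega) h' (by omega) (by omega) (by omega) (by omega) (by grind)
    · obtain ⟨c, hc⟩ := hpar
      obtain ⟨s, rfl⟩ := Nat.exists_eq_add_of_le' hr
      have h₁ := h.append_run (n := n) (q' := List.replicate 9 true) true (n + 9 - c) (c - 9) 0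
        (by omega) (by simp only [← List.replicate_add]; congr 1; omega)
      rw [descLengths_succ, altWord, ← List.append_assoc]
      refine (h₁.drop_queue.append_altWord _ _).mono ?_
      rw [length_descLengths, List.length_replicate]
      omega

/-- For odd `m` and `1 ≤ r` with `m ≥ 2r − 1`, the word `O_{m,r} = W(m, m−2, …, m−2r+2)`
(of length `r(m−r+1)`) contains twins of double length at least `r(m−r+1) − 23`. -/
theorem statement10 (m r : ℕ) (hm : Odd m) (hr : 1 ≤ r) (hmr : 2 * r - 1 ≤ m) :
    ∃ t : ℕ,
      HasTwins (altWord ((List.range r).map fun k => m - 2 * k) true) t ∧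
      r * (m - r + 1) ≤ 2 * t + 23 := by
  have key : TwinsUpTo (altWord (descLengths m r) true) [] 16 := by
    obtain hr8 | hr8 := Nat.lt_or_ge 8 r
    · exact TwinsUpTo.nil.append_descLengths (y := 0) hr (by omega) (by omega) (by omega)
        (by grind)
    · refine (TwinsUpTo.nil.append_altWord (descLengths m r) true).mono ?_
      rw [length_descLengths]
      omega
  obtain ⟨v, hv, hl⟩ := key
  rw [List.append_nil] at hv
  refine ⟨v.length, hv.hasTwins, ?_⟩
  rw [length_altWord, sum_descLengths m r (by omega), List.length_nil] at hl
  omega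
end

section
/- Let W be a word over a finite alphabet and let W = U_1 U_2 ⋯ U_m be its decomposition into runs. Then W is a shuffle square if and only if there exists a finite multiset E of unordered pairs {i, j} with 1 ≤ i ≤ j ≤ m (pairs with i = j are loops) such that: (1) whenever {i, j} ∈ E, the runs U_i and U_j consist of the same letter; (2) for each i, the degree of i in E (the number of pairs containing i, counted with multiplicity, where each loop at i contributes 2) equals the length |U_i|; and (3) E is nest-free, i.e., there is no pair of members {i, j} and {k, l} of E (with i ≤ j, k ≤ l) having {i,j} ∩ {k,l} = ∅, i < k, and l < j. -/
/-- `RunDecomp w rs` says that `rs` is the run decomposition of `w`: the word `w` is the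
concatenation of blocks `p.1 ^ p.2` for `p ∈ rs`, all blocks are nonempty, and the letters
of consecutive blocks differ (so the blocks are exactly the maximal runs of `w`). -/
def RunDecomp {α : Type*} (w : List α) (rs : List (α × ℕ)) : Prop :=
  w = (rs.map fun p => List.replicate p.2 p.1).flatten ∧
  (∀ p ∈ rs, 0 < p.2) ∧
  List.Chain' (fun p q => p.1 ≠ q.1) rs

namespace Interleave

theorem perm_append {α : Type*} {x y z : List α} (h : Interleave x y z) :
    (x ++ y).Perm z := by
  induction h with
  | nil => exact .refl _
  | cons_left a _ ih => exact ih.cons a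
  | cons_right a _ ih => exact List.perm_middle.trans (ih.cons a)

theorem sublist_left {α : Type*} {x y z : List α} (h : Interleave x y z) : x.Sublist z := by
  induction h with
  | nil => exact .refl _
  | cons_left a _ ih => exact ih.cons_cons a
  | cons_right a _ ih => exact ih.cons a

theorem sublist_right {α : Type*} {x y z : List α} (h : Interleave x y z) : y.Sublist z := by
  induction h with
  | nil => exact .refl _
  | cons_left a _ ih => exact ih.cons a
  | cons_right a _ ih => exact ih.cons_cons a

theorem map {α β : Type*} (g : α → β) {x y z : List α} (h : Interleave x y z) :
    Interleave (x.map g) (y.map g) (z.map g) := by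
  induction h with
  | nil => exact .nil
  | cons_left a _ ih => exact ih.cons_left (g a)
  | cons_right a _ ih => exact ih.cons_right (g a)

theorem exists_of_map {α β : Type*} (g : α → β) {x y : List β} {z : List α}
    (h : Interleave x y (z.map g)) :
    ∃ f s : List α, Interleave f s z ∧ f.map g = x ∧ s.map g = y := by
  generalize hw : z.map g = w at h
  induction h generalizing z with
  | nil =>
    obtain rfl := List.map_eq_nil_iff.mp hw
    exact ⟨[], [], .nil, rfl, rfl⟩
  | cons_left a _ ih =>
    obtain ⟨b, z, rfl, rfl, hz⟩ := List.map_eq_cons_iff.mp hw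
    obtain ⟨f, s, h, rfl, rfl⟩ := ih hz
    exact ⟨b :: f, s, h.cons_left b, rfl, rfl⟩
  | cons_right a _ ih =>
    obtain ⟨b, z, rfl, rfl, hz⟩ := List.map_eq_cons_iff.mp hw
    obtain ⟨f, s, h, rfl, rfl⟩ := ih hz
    exact ⟨f, b :: s, h.cons_right b, rfl, rfl⟩

theorem nil_left {α : Type*} (y : List α) : Interleave [] y y := by
  induction y with
  | nil => exact .nil
  | cons a _ ih => exact ih.cons_right a

theorem nil_right {α : Type*} (x : List α) : Interleave x [] x := by
  induction x with
  | nil => exact .nil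
  | cons a _ ih => exact ih.cons_left a

theorem merge {α : Type*} (le : α → α → Bool) (x y : List α) :
    Interleave x y (x.merge y le) := by
  fun_induction List.merge x y le with
  | case1 y => exact nil_left y
  | case2 x => exact nil_right x
  | case3 a x b y _ ih => exact ih.cons_left a
  | case4 a x b y _ ih => exact ih.cons_right b

end Interleave

/-- Two sorted words interleave to every sorted rearrangement of their concatenation. -/
theorem interleave_of_perm_of_pairwise_le {ι : Type*} [LinearOrder ι] {x y z : List ι}
    (hx : x.Pairwise (· ≤ ·)) (hy : y.Pairwise (· ≤ ·)) (hz : z.Pairwise (· ≤ ·))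
    (h : (x ++ y).Perm z) : Interleave x y z := by
  have hm := Interleave.merge (fun a b : ι => decide (a ≤ b)) x y
  have hs : (x.merge y fun a b : ι => decide (a ≤ b)).Pairwise (· ≤ ·) := by
    have := List.pairwise_merge (le := fun a b : ι => decide (a ≤ b))
      (by simpa using fun a b c => le_trans) (by simpa using le_total) x y
      (by simpa using hx) (by simpa using hy)
    simpa using this
  rwa [(hm.perm_append.symm.trans h).eq_of_pairwise (fun _ _ _ _ => le_antisymm) hs hz] at hm

theorem sum_map_endpoints_eq_count {ι : Type*} [DecidableEq ι] (E : Multiset (ι × ι)) (i : ι) :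
    (E.map fun p => (if p.1 = i then 1 else 0) + (if p.2 = i then 1 else 0)).sum =
      (E.map Prod.fst).count i + (E.map Prod.snd).count i := by
  induction E using Multiset.induction_on with
  | empty => simp
  | cons p E ih =>
    simp only [Multiset.map_cons, Multiset.sum_cons, ih, Multiset.count_cons, eq_comm (a := i)]
    omega

/-- A sorted word of indices, read through a labelling `g`, is a shuffle square iff its letters
can be paired up by a nest-free multiset of edges joining equally labelled indices. -/
theorem isShuffleSquare_map_iff {ι α : Type*} [LinearOrder ι] (g : ι → α) {z : List ι}
    (hz : z.Pairwise (· ≤ ·)) :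
    IsShuffleSquare (z.map g) ↔
      ∃ E : Multiset (ι × ι),
        (∀ p ∈ E, p.1 ≤ p.2) ∧
        (∀ p ∈ E, g p.1 = g p.2) ∧
        (∀ i : ι,
          (E.map fun p =>
            (if p.1 = i then 1 else 0) + (if p.2 = i then 1 else 0)).sum = z.count i) ∧
        (∀ p ∈ E, ∀ q ∈ E, ¬ (p.1 < q.1 ∧ q.2 < p.2)) := by
  simp only [sum_map_endpoints_eq_count]
  constructor
  · rintro ⟨x, hx⟩
    obtain ⟨f, s, h, hf, hs⟩ := hx.exists_of_map g
    have hlen : f.length = s.length := by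
      rw [← List.length_map (f := g), hf, ← hs, List.length_map]
    have hfs := hz.sublist h.sublist_left
    have hss := hz.sublist h.sublist_right
    have hmem : ∀ p ∈ f.zip s, ∃ (k : ℕ) (hk : k < f.length), p = (f[k], s[k]) := by
      intro p hp
      obtain ⟨k, hk, rfl⟩ := List.mem_iff_getElem.mp hp
      exact ⟨k, by simp at hk; omega, by simp⟩
    refine ⟨((f.zip s).map fun p => (min p.1 p.2, max p.1 p.2) : List (ι × ι)), ?_, ?_, ?_, ?_⟩
    · simp only [Multiset.mem_coe, List.mem_map]
      rintro _ ⟨p, -, rfl⟩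
      exact min_le_max
    · simp only [Multiset.mem_coe, List.mem_map]
      rintro _ ⟨p, hp, rfl⟩
      obtain ⟨k, hk, rfl⟩ := hmem p hp
      have hg : g f[k] = g s[k] := by
        have : (f.map g)[k]'(by simpa) = (s.map g)[k]'(by simp; omega) := by
          simp only [hf, hs]
        simpa using this
      rcases le_total f[k] s[k] with hle | hle <;> simp [hle, hg]
    · intro i
      have key : ∀ l : List (ι × ι),
          (l.map fun p => min p.1 p.2).count i + (l.map fun p => max p.1 p.2).count i =
            (l.map Prod.fst).count i + (l.map Prod.snd).count i := by
        intro l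
        induction l with
        | nil => rfl
        | cons p l ih =>
          simp only [List.map_cons, List.count_cons]
          rcases le_total p.1 p.2 with hle | hle <;> simp only [hle, inf_of_le_left, inf_of_le_right,
            sup_of_le_left, sup_of_le_right] <;> omega
      have := key (f.zip s)
      rw [List.map_fst_zip hlen.le, List.map_snd_zip hlen.ge] at this
      simpa [Function.comp_def, ← h.perm_append.count_eq] using this
    · have mono : ∀ (j k : ℕ) (hjk : j ≤ k) (hk : k < f.length), f[j] ≤ f[k] ∧ s[j] ≤ s[k] := by
        intro j k hjk hk
        rcases hjk.eq_or_lt with rfl | hlt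
        · exact ⟨le_rfl, le_rfl⟩
        · exact ⟨List.pairwise_iff_getElem.mp hfs _ _ _ _ hlt,
            List.pairwise_iff_getElem.mp hss _ _ _ _ hlt⟩
      simp only [Multiset.mem_coe, List.mem_map]
      rintro _ ⟨p, hp, rfl⟩ _ ⟨q, hq, rfl⟩ ⟨h₁, h₂⟩
      obtain ⟨j, hj, rfl⟩ := hmem p hp
      obtain ⟨k, hk, rfl⟩ := hmem q hq
      rcases le_total j k with hjk | hjk
      · obtain ⟨h₃, h₄⟩ := mono j k hjk hk
        exact (max_le_max h₃ h₄).not_gt h₂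
      · obtain ⟨h₃, h₄⟩ := mono k j hjk hj
        exact (min_le_min h₃ h₄).not_gt h₁
  · rintro ⟨E, -, hg, hdeg, hnest⟩
    set L : List (ι × ι) := ((E.map toLex).sort (· ≤ ·)).map ofLex with hL
    have hLE : (L : Multiset (ι × ι)) = E := by
      rw [hL, ← Multiset.map_coe, Multiset.sort_eq, Multiset.map_map]
      exact Multiset.map_id' E
    have hmem : ∀ p ∈ L, p ∈ E := fun p hp => by rwa [← hLE, Multiset.mem_coe]
    have hsort : L.Pairwise fun p q => p.1 ≤ q.1 ∧ p.2 ≤ q.2 := by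
      have h : L.Pairwise fun p q => toLex p ≤ toLex q := by
        rw [hL, List.pairwise_map]
        exact Multiset.pairwise_sort (E.map toLex) (· ≤ ·)
      refine h.imp_of_mem fun {p q} hp hq hpq => ?_
      rcases Prod.Lex.toLex_le_toLex.mp hpq with hlt | ⟨heq, hle⟩
      · exact ⟨hlt.le, not_lt.mp fun hlt' => hnest p (hmem p hp) q (hmem q hq) ⟨hlt, hlt'⟩⟩
      · exact ⟨heq.le, hle⟩
    have hperm : (L.map Prod.fst ++ L.map Prod.snd).Perm z := by
      rw [List.perm_iff_count]
      intro i
      rw [List.count_append, ← hdeg, ← hLE]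
      simp
    have hint := (interleave_of_perm_of_pairwise_le
      (List.pairwise_map.mpr (hsort.imp And.left))
      (List.pairwise_map.mpr (hsort.imp And.right)) hz hperm).map g
    refine ⟨(L.map Prod.fst).map g, ?_⟩
    convert hint using 1
    simpa using fun a b hab => hg (a, b) (hmem _ hab)

theorem pairwise_le_flatMap_replicate {ι : Type*} [Preorder ι] {l : List ι}
    (hl : l.Pairwise (· ≤ ·)) (n : ι → ℕ) :
    (l.flatMap fun i => List.replicate (n i) i).Pairwise (· ≤ ·) := by
  rw [List.pairwise_flatMap]
  refine ⟨fun i _ => List.pairwise_replicate.mpr (.inr le_rfl), hl.imp fun h x hx y hy => ?_⟩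
  rwa [List.eq_of_mem_replicate hx, List.eq_of_mem_replicate hy]

theorem count_flatMap_replicate {ι : Type*} [DecidableEq ι] {l : List ι} (hl : l.Nodup)
    (n : ι → ℕ) {i : ι} (hi : i ∈ l) :
    (l.flatMap fun j => List.replicate (n j) j).count i = n i := by
  rw [List.count_flatMap]
  simp only [Function.comp_def, List.count_replicate, beq_iff_eq]
  rw [List.sum_map_eq_nsmul_single i _ fun j hj _ => if_neg hj, List.count_eq_one_of_mem hl hi]
  simp

/-- A word `w` with run decomposition `U₁ ⋯ U_m` is a shuffle square if and only if there
is a multiset `E` of (unordered, represented by `p.1 ≤ p.2`; loops allowed) pairs of run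
indices such that: matched runs carry the same letter, the degree of each run index equals
the length of the corresponding run (loops counting twice), and `E` is nest-free. -/
theorem statement14 {α : Type*} [Fintype α] [DecidableEq α]
    (w : List α) (rs : List (α × ℕ)) (hrd : RunDecomp w rs) :
    IsShuffleSquare w ↔
      ∃ E : Multiset (Fin rs.length × Fin rs.length),
        (∀ p ∈ E, p.1 ≤ p.2) ∧
        (∀ p ∈ E, (rs.get p.1).1 = (rs.get p.2).1) ∧
        (∀ i : Fin rs.length,
          (E.map fun p =>
            (if p.1 = i then 1 else 0) + (if p.2 = i then 1 else 0)).sum = (rs.get i).2) ∧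
        (∀ p ∈ E, ∀ q ∈ E, ¬ (p.1 < q.1 ∧ q.2 < p.2)) := by
  have hw : w = ((List.finRange rs.length).flatMap fun i =>
      List.replicate (rs.get i).2 i).map fun i => (rs.get i).1 := by
    rw [hrd.1, List.map_flatMap, List.flatMap_def]
    conv_lhs => rw [← List.map_get_finRange rs, List.map_map]
    simp [Function.comp_def]
  have hcount : ∀ i, ((List.finRange rs.length).flatMap fun i =>
      List.replicate (rs.get i).2 i).count i = (rs.get i).2 := fun i =>
    count_flatMap_replicate (List.nodup_finRange _) (fun i => (rs.get i).2) (List.mem_finRange i)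
  have hsorted := pairwise_le_flatMap_replicate (List.pairwise_le_finRange rs.length)
    fun i => (rs.get i).2
  rw [hw, isShuffleSquare_map_iff _ hsorted]
  simp only [hcount]
end

section
/- Let m ≥ 2 and let W = 0^{a_0} 1 0^{a_1} 1 0^{a_2} ⋯ 1 0^{a_{2m}} be an even binary word, where a_1,…,a_{2m−1} ≥ 1 and a_0, a_{2m} ≥ 0 (so W has exactly 2m ones, each forming a 1-run of length one). Then W is a shuffle square with alternating 1's — i.e., W has perfect twins (X, Y) such that for every k with 1 ≤ k ≤ m, the (2k−1)-st occurrence of 1 in W belongs to X and the (2k)-th occurrence of 1 belongs to Y — if and only if there exist integers r_0, r_1, …, r_{2m} with 0 ≤ r_i ≤ a_i for all i, satisfying 2 r_0 = a_0 + a_1 − r_1, 2 r_{2i} = a_{2i} + a_{2i+1} − r_{2i−1} − r_{2i+1} for every 1 ≤ i ≤ m−1, and 2 r_{2m} = a_{2m} − r_{2m−1}. -/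
/-- The subsequence of the word `w` formed by the positions belonging to `S`
(in increasing order of positions). -/
def subseqIdx (w : List Bool) (S : Finset ℕ) : List Bool :=
  ((List.range w.length).filter fun p => decide (p ∈ S)).map fun p => w.getD p false

/-- The position (0-based) of the `k`-th occurrence (0-based) of the letter `1` in the
word `0^{a 0} 1 0^{a 1} 1 0^{a 2} ⋯ 1 0^{a (2m)}`. -/
def onePos (a : ℕ → ℕ) (k : ℕ) : ℕ :=
  a 0 + k + ∑ j ∈ Finset.range k, a (j + 1)

open Finset

/-- The word `0^{a 0} 1 0^{a 1} 1 ⋯ 1 0^{a n}`. -/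
def gapWord (a : ℕ → ℕ) (n : ℕ) : List Bool :=
  List.replicate (a 0) false ++
    ((List.range n).map fun i => true :: List.replicate (a (i + 1)) false).flatten

theorem gapWord_zero (a : ℕ → ℕ) : gapWord a 0 = List.replicate (a 0) false := by
  simp [gapWord]

theorem gapWord_succ (a : ℕ → ℕ) (n : ℕ) :
    gapWord a (n + 1) = gapWord a n ++ [true] ++ List.replicate (a (n + 1)) false := by
  simp [gapWord, List.range_succ]

theorem gapWord_succ' (a : ℕ → ℕ) (n : ℕ) :
    gapWord a (n + 1) =
      List.replicate (a 0) false ++ true :: gapWord (fun i => a (i + 1)) n := by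
  simp [gapWord, List.range_succ_eq_map, Function.comp_def]

theorem length_gapWord (a : ℕ → ℕ) (n : ℕ) : (gapWord a n).length = onePos a n := by
  induction n with
  | zero => simp [gapWord_zero, onePos]
  | succ n ih => simp [gapWord_succ, ih, onePos, sum_range_succ]; omega

theorem replicate_false_append_true_inj {p q : ℕ} {u v : List Bool} :
    List.replicate p false ++ true :: u = List.replicate q false ++ true :: v ↔
      p = q ∧ u = v := by
  induction p generalizing q with
  | zero => cases q <;> simp [List.replicate_succ]
  | succ p ih => cases q <;> simp [List.replicate_succ, ih]

theorem gapWord_inj {g h : ℕ → ℕ} {n : ℕ} :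
    gapWord g n = gapWord h n ↔ ∀ i ≤ n, g i = h i := by
  induction n generalizing g h with
  | zero => simp [gapWord_zero, List.replicate_inj]
  | succ n ih =>
    rw [gapWord_succ', gapWord_succ', replicate_false_append_true_inj, ih]
    constructor
    · rintro ⟨h0, hs⟩ (_ | i) hi
      · exact h0
      · exact hs i (by omega)
    · exact fun H => ⟨H 0 (by omega), fun i hi => H (i + 1) (by omega)⟩

theorem subseqIdx_append (w v : List Bool) (S : Finset ℕ) :
    subseqIdx (w ++ v) S = subseqIdx w S ++
      ((List.range v.length).filter fun p => decide (w.length + p ∈ S)).map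
        fun p => v.getD p false := by
  unfold subseqIdx
  rw [List.length_append, List.range_add, List.filter_append, List.map_append]
  congr 1
  · refine List.map_congr_left fun p hp => ?_
    have : p < w.length := by simpa using (List.mem_filter.1 hp).1
    exact List.getD_append _ _ _ _ this
  · rw [List.filter_map, List.map_map]
    refine List.map_congr_left fun p _ => ?_
    simp [List.getElem?_append_right]

theorem subseqIdx_append_singleton (w : List Bool) (b : Bool) (S : Finset ℕ) :
    subseqIdx (w ++ [b]) S = subseqIdx w S ++ if w.length ∈ S then [b] else [] := by
  rw [subseqIdx_append]
  split_ifs with h <;> simp [h, List.range_succ]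

theorem subseqIdx_append_replicate (w : List Bool) (n : ℕ) (S : Finset ℕ) :
    subseqIdx (w ++ List.replicate n false) S =
      subseqIdx w S ++ List.replicate #{j ∈ range n | w.length + j ∈ S} false := by
  rw [subseqIdx_append]
  congr 1
  rw [List.eq_replicate_iff]
  constructor
  · simp only [List.length_map, List.length_replicate]
    rfl
  · simp only [List.mem_map]
    rintro _ ⟨p, -, rfl⟩
    by_cases hp : p < n <;> simp [List.getD, hp]

/-- The position of the start of the `i`-th block of zeros in `gapWord a n`. -/
def blockStart (a : ℕ → ℕ) (i : ℕ) : ℕ :=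
  i + ∑ j ∈ range i, a j

theorem onePos_eq_blockStart_add (a : ℕ → ℕ) (i : ℕ) : onePos a i = blockStart a i + a i := by
  have h := sum_range_succ' a i
  rw [sum_range_succ] at h
  simp only [onePos, blockStart]
  omega

theorem blockStart_succ (a : ℕ → ℕ) (i : ℕ) : blockStart a (i + 1) = onePos a i + 1 := by
  rw [onePos_eq_blockStart_add]
  simp only [blockStart, sum_range_succ]
  omega

theorem onePos_strictMono (a : ℕ → ℕ) : StrictMono (onePos a) :=
  strictMono_nat_of_lt_succ fun i => by
    rw [onePos_eq_blockStart_add a (i + 1), blockStart_succ]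
    omega

theorem eq_of_mem_block {a : ℕ → ℕ} {i j p : ℕ} (hi : blockStart a i ≤ p) (hi' : p ≤ onePos a i)
    (hj : blockStart a j ≤ p) (hj' : p ≤ onePos a j) : i = j := by
  have key : ∀ {i j : ℕ}, p ≤ onePos a i → blockStart a j ≤ p → ¬i < j := by
    intro i j h h' hij
    obtain ⟨k, rfl⟩ := Nat.exists_eq_add_of_lt hij
    rw [blockStart_succ] at h'
    have := (onePos_strictMono a).monotone (Nat.le_add_right i k)
    omega
  exact le_antisymm (not_lt.1 (key hj' hi)) (not_lt.1 (key hi' hj))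

/-- The number of positions of `S` in the `i`-th block of zeros of `gapWord a n`. -/
def blockCount (a : ℕ → ℕ) (S : Finset ℕ) (i : ℕ) : ℕ :=
  #{j ∈ range (a i) | blockStart a i + j ∈ S}

theorem blockCount_le (a : ℕ → ℕ) (S : Finset ℕ) (i : ℕ) : blockCount a S i ≤ a i :=
  (card_filter_le _ _).trans_eq (card_range _)

theorem blockCount_add_blockCount_sdiff {a : ℕ → ℕ} {n i : ℕ} (hi : i ≤ n) (S : Finset ℕ) :
    blockCount a S i + blockCount a (range (onePos a n) \ S) i = a i := by
  have h : blockCount a (range (onePos a n) \ S) i =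
      #{j ∈ range (a i) | blockStart a i + j ∉ S} := by
    refine congrArg card (filter_congr fun j hj => ?_)
    have h1 := (onePos_strictMono a).monotone hi
    have h2 := onePos_eq_blockStart_add a i
    simp only [mem_range, mem_sdiff] at hj ⊢
    exact and_iff_right (by omega)
  rw [h, blockCount, card_filter_add_card_filter_not, card_range]

theorem subseqIdx_gapWord_zero (a : ℕ → ℕ) (S : Finset ℕ) :
    subseqIdx (gapWord a 0) S = List.replicate (blockCount a S 0) false := by
  have h := subseqIdx_append_replicate [] (a 0) S
  simpa [gapWord_zero, blockCount, blockStart, subseqIdx] using h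

theorem subseqIdx_gapWord_succ (a : ℕ → ℕ) (S : Finset ℕ) (n : ℕ) :
    subseqIdx (gapWord a (n + 1)) S =
      subseqIdx (gapWord a n) S ++ (if onePos a n ∈ S then [true] else []) ++
        List.replicate (blockCount a S (n + 1)) false := by
  rw [gapWord_succ, subseqIdx_append_replicate, subseqIdx_append_singleton, length_gapWord,
    blockCount, blockStart_succ, List.length_append, length_gapWord, List.length_singleton]

/-- If `S` contains exactly the even-indexed ones, the blocks `2i + 1` and `2i + 2` merge. -/
theorem subseqIdx_gapWord_of_even {a : ℕ → ℕ} {S : Finset ℕ} {m : ℕ}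
    (h : ∀ k < m, onePos a (2 * k) ∈ S ∧ onePos a (2 * k + 1) ∉ S) {g : ℕ → ℕ}
    (h0 : g 0 = blockCount a S 0)
    (hg : ∀ i < m, g (i + 1) = blockCount a S (2 * i + 1) + blockCount a S (2 * i + 2)) :
    subseqIdx (gapWord a (2 * m)) S = gapWord g m := by
  induction m with
  | zero => rw [subseqIdx_gapWord_zero, gapWord_zero, h0]
  | succ m ih =>
    have ih := ih (fun k hk => h k (by omega)) (fun k hk => hg k (by omega))
    obtain ⟨h1, h2⟩ := h m (by omega)
    rw [show 2 * (m + 1) = 2 * m + 1 + 1 by ring, subseqIdx_gapWord_succ,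
      subseqIdx_gapWord_succ, ih, if_pos h1, if_neg h2, gapWord_succ, hg m (by omega)]
    simp

/-- If `S` contains exactly the odd-indexed ones, the blocks `2i` and `2i + 1` merge; the first
`y (2m + 1)` zeros following the word are arbitrary. -/
theorem subseqIdx_gapWord_of_odd {a : ℕ → ℕ} {S : Finset ℕ} {m : ℕ}
    (h : ∀ k < m, onePos a (2 * k) ∉ S ∧ onePos a (2 * k + 1) ∈ S) {y : ℕ → ℕ}
    (hy : ∀ i ≤ 2 * m, y i = blockCount a S i) :
    subseqIdx (gapWord a (2 * m)) S ++ List.replicate (y (2 * m + 1)) false =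
      gapWord (fun i => y (2 * i) + y (2 * i + 1)) m := by
  induction m with
  | zero =>
    rw [mul_zero, subseqIdx_gapWord_zero, gapWord_zero]
    simp [hy 0]
  | succ m ih =>
    have ih := ih (fun k hk => h k (by omega)) (fun k hk => hy k (by omega))
    obtain ⟨h1, h2⟩ := h m (by omega)
    rw [gapWord_succ, ← ih, show 2 * (m + 1) = 2 * m + 1 + 1 by ring, subseqIdx_gapWord_succ,
      subseqIdx_gapWord_succ, if_neg h1, if_pos h2, ← hy _ (by omega), ← hy _ (by omega)]
    simp

/-- Supports with prescribed block counts that contain exactly the even-indexed ones exist. -/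
theorem exists_blockCount_eq {a r : ℕ → ℕ} {m : ℕ} (hr : ∀ i ≤ 2 * m, r i ≤ a i) :
    ∃ S ⊆ range (onePos a (2 * m)),
      (∀ k < m, onePos a (2 * k) ∈ S ∧ onePos a (2 * k + 1) ∉ S) ∧
        ∀ i ≤ 2 * m, blockCount a S i = r i := by
  classical
  let P : ℕ → Prop := fun p => ∃ i, blockStart a i ≤ p ∧
    (p < blockStart a i + r i ∧ i ≤ 2 * m ∨ p = onePos a i ∧ Even i)
  have hP : ∀ {i j : ℕ}, i ≤ 2 * m → j ≤ a i →
      (P (blockStart a i + j) ↔ j < r i ∨ j = a i ∧ Even i) := by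
    intro i j hi hj
    have hi' := onePos_eq_blockStart_add a i
    constructor
    · rintro ⟨k, hk, hk'⟩
      have hk'' := onePos_eq_blockStart_add a k
      obtain rfl : i = k := by
        refine eq_of_mem_block (p := blockStart a i + j) (by omega) (by omega) hk ?_
        rcases hk' with ⟨h, hkm⟩ | ⟨h, -⟩
        · have := hr k hkm
          omega
        · omega
      rcases hk' with h | h
      · exact Or.inl (by omega)
      · exact Or.inr ⟨by omega, h.2⟩
    · rintro (h | h)
      · exact ⟨i, by omega, Or.inl ⟨by omega, hi⟩⟩
      · exact ⟨i, by omega, Or.inr ⟨by omega, h.2⟩⟩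
  refine ⟨{p ∈ range (onePos a (2 * m)) | P p}, filter_subset _ _, fun k hk => ?_,
    fun i hi => ?_⟩
  · have h1 : onePos a (2 * k) < onePos a (2 * m) := onePos_strictMono a (by omega)
    constructor
    · rw [mem_filter, mem_range]
      refine ⟨h1, ?_⟩
      rw [onePos_eq_blockStart_add, hP (by omega) le_rfl]
      exact Or.inr ⟨rfl, even_two_mul k⟩
    · rw [mem_filter, onePos_eq_blockStart_add a (2 * k + 1), hP (by omega) le_rfl]
      rintro ⟨-, h | h⟩
      · have := hr (2 * k + 1) (by omega)
        omega
      · exact Nat.not_even_two_mul_add_one k h.2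
  · rw [← card_range (r i), blockCount]
    refine congrArg card (Finset.ext fun j => ?_)
    have h1 := (onePos_strictMono a).monotone hi
    have h2 := onePos_eq_blockStart_add a i
    have h3 := hr i hi
    simp only [mem_filter, mem_range]
    constructor
    · rintro ⟨hj, -, h⟩
      rcases (hP hi hj.le).1 h with h | h
      · exact h
      · omega
    · exact fun hj => ⟨by omega, by omega, (hP hi (by omega)).2 (Or.inl hj)⟩

/-- For supports `S` with alternating ones, being twins amounts to a linear system for the
block counts of `S`. -/
theorem subseqIdx_gapWord_eq_compl_iff {a : ℕ → ℕ} {S : Finset ℕ} {m : ℕ} (hm : 1 ≤ m)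
    (h : ∀ k < m, onePos a (2 * k) ∈ S ∧ onePos a (2 * k + 1) ∉ S) {r : ℕ → ℕ}
    (hr : ∀ i ≤ 2 * m, blockCount a S i = r i) :
    subseqIdx (gapWord a (2 * m)) S =
        subseqIdx (gapWord a (2 * m)) (range (onePos a (2 * m)) \ S) ↔
      2 * r 0 + r 1 = a 0 + a 1 ∧
        (∀ i, 1 ≤ i → i ≤ m - 1 →
          2 * r (2 * i) + r (2 * i - 1) + r (2 * i + 1) = a (2 * i) + a (2 * i + 1)) ∧
        2 * r (2 * m) + r (2 * m - 1) = a (2 * m) := by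
  have hle : ∀ i ≤ 2 * m, r i ≤ a i := fun i hi => hr i hi ▸ blockCount_le a S i
  have hX := subseqIdx_gapWord_of_even h
    (g := fun i => if i = 0 then r 0 else r (2 * i - 1) + r (2 * i))
    (by simp [hr]) (fun i hi => by
      rw [if_neg (by omega), hr _ (by omega), hr _ (by omega)]
      rfl)
  have hY := subseqIdx_gapWord_of_odd (a := a) (S := range (onePos a (2 * m)) \ S) (m := m)
    (fun k hk => ⟨by simp [(h k hk).1], by
      simpa [(h k hk).2] using onePos_strictMono a (by omega)⟩)
    (y := fun i => if i ≤ 2 * m then a i - r i else 0)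
    (fun i hi => by
      have := blockCount_add_blockCount_sdiff hi (a := a) S
      rw [hr i hi] at this
      rw [if_pos hi]
      omega)
  rw [if_neg (by omega), List.replicate_zero, List.append_nil] at hY
  rw [hX, hY, gapWord_inj]
  constructor
  · intro H
    refine ⟨?_, fun i hi hi' => ?_, ?_⟩
    · have := H 0 (by omega)
      have h0 := hle 0 (by omega)
      have h1 := hle 1 (by omega)
      rw [if_pos rfl, if_pos (by omega), if_pos (by omega)] at this
      simp only [mul_zero, zero_add] at this
      omega
    · have := H i (by omega)
      have h0 := hle (2 * i) (by omega)
      have h1 := hle (2 * i + 1) (by omega)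
      rw [if_neg (by omega), if_pos (by omega), if_pos (by omega)] at this
      omega
    · have := H m le_rfl
      have h0 := hle (2 * m) le_rfl
      rw [if_neg (by omega), if_pos le_rfl, if_neg (by omega)] at this
      omega
  · rintro ⟨H0, H1, H2⟩ i hi
    obtain rfl | hi0 := Nat.eq_zero_or_pos i
    · have h0 := hle 0 (by omega)
      have h1 := hle 1 (by omega)
      rw [if_pos rfl, if_pos (by omega), if_pos (by omega)]
      simp only [mul_zero, zero_add]
      omega
    · have h0 := hle (2 * i) (by omega)
      obtain rfl | him := hi.eq_or_lt
      · rw [if_neg (by omega), if_pos le_rfl, if_neg (by omega)]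
        omega
      · have h1 := hle (2 * i + 1) (by omega)
        have := H1 i hi0 (by omega)
        rw [if_neg (by omega), if_pos (by omega), if_pos (by omega)]
        omega

/-- For `m ≥ 2`, an even binary word `W = 0^{a₀} 1 0^{a₁} 1 0^{a₂} ⋯ 1 0^{a_{2m}}` with
`a₁, …, a_{2m−1} ≥ 1` is a shuffle square with alternating `1`'s (i.e. `W` has perfect
twins `(X, Y)`, given here by the support `S` of `X` and its complement, such that for
every `k` the `(2k−1)`-st occurrence of `1` lies in `X` and the `(2k)`-th in `Y`) if and
only if the system of equations `2r₀ = a₀ + a₁ − r₁`,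
`2r_{2i} = a_{2i} + a_{2i+1} − r_{2i−1} − r_{2i+1}` (for `1 ≤ i ≤ m−1`), and
`2r_{2m} = a_{2m} − r_{2m−1}` has an integer solution with `0 ≤ rᵢ ≤ aᵢ` for all `i`. -/
theorem statement15 (m : ℕ) (hm : 2 ≤ m) (a : ℕ → ℕ)
    (hpos : ∀ i, 1 ≤ i → i ≤ 2 * m - 1 → 1 ≤ a i)
    (W : List Bool)
    (hW : W = List.replicate (a 0) false ++
      ((List.range (2 * m)).map fun i => true :: List.replicate (a (i + 1)) false).flatten)
    (heven : Even (W.count false)) :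
    (∃ S : Finset ℕ, S ⊆ Finset.range W.length ∧
        subseqIdx W S = subseqIdx W (Finset.range W.length \ S) ∧
        ∀ k < m, onePos a (2 * k) ∈ S ∧ onePos a (2 * k + 1) ∈ Finset.range W.length \ S)
      ↔
    (∃ r : ℕ → ℕ, (∀ i ≤ 2 * m, r i ≤ a i) ∧
        2 * r 0 + r 1 = a 0 + a 1 ∧
        (∀ i, 1 ≤ i → i ≤ m - 1 →
          2 * r (2 * i) + r (2 * i - 1) + r (2 * i + 1) = a (2 * i) + a (2 * i + 1)) ∧
        2 * r (2 * m) + r (2 * m - 1) = a (2 * m)) := by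
  obtain rfl : W = gapWord a (2 * m) := hW
  rw [length_gapWord]
  constructor
  · rintro ⟨S, -, hS, h⟩
    exact ⟨blockCount a S, fun i _ => blockCount_le a S i,
      (subseqIdx_gapWord_eq_compl_iff (by omega)
        (fun k hk => ⟨(h k hk).1, (mem_sdiff.1 (h k hk).2).2⟩) fun _ _ => rfl).1 hS⟩
  · rintro ⟨r, hr, H⟩
    obtain ⟨S, hS, h, hc⟩ := exists_blockCount_eq hr
    exact ⟨S, hS, (subseqIdx_gapWord_eq_compl_iff (by omega) h hc).2 H, fun k hk =>
      ⟨(h k hk).1, mem_sdiff.2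
        ⟨mem_range.2 (onePos_strictMono a (by omega)), (h k hk).2⟩⟩⟩
end

section
/- If a word W over a finite alphabet contains a pair of twins of length t, then W contains a pair of monotone twins of length t; that is, there exist twins X = w_{i_1} ⋯ w_{i_t} and Y = w_{j_1} ⋯ w_{j_t} in W with i_h < j_h for every h with 1 ≤ h ≤ t. -/
/-- If a word `w` contains a pair of twins of length `t` (two strictly increasing
sequences of positions with disjoint supports spelling the same word), then it contains a
pair of *monotone* twins of length `t`, i.e. twins in which each position of the first
twin precedes the corresponding position of the second twin. -/
theorem statement16 {α : Type*} [Fintype α] (w : List α) (t : ℕ)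
    (i j : Fin t → Fin w.length) (hi : StrictMono i) (hj : StrictMono j)
    (hdisj : ∀ h h', i h ≠ j h')
    (heq : ∀ h, w.get (i h) = w.get (j h)) :
    ∃ i' j' : Fin t → Fin w.length, StrictMono i' ∧ StrictMono j' ∧
      (∀ h h', i' h ≠ j' h') ∧
      (∀ h, w.get (i' h) = w.get (j' h)) ∧
      (∀ h, i' h < j' h) := by
  refine ⟨fun h => min (i h) (j h), fun h => max (i h) (j h), fun a b hab => ?_,
    fun a b hab => ?_, fun a b hab => ?_, fun h => ?_, fun h => ?_⟩
  · exact min_lt_min (hi hab) (hj hab)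
  · exact max_lt_max (hi hab) (hj hab)
  · dsimp only at hab
    rcases min_choice (i a) (j a) with h₁ | h₁ <;> rcases max_choice (i b) (j b) with h₂ | h₂ <;>
      rw [h₁, h₂] at hab
    · obtain rfl := hi.injective hab
      exact hdisj a a (le_antisymm (min_eq_left_iff.mp h₁) (max_eq_left_iff.mp h₂))
    · exact hdisj a b hab
    · exact hdisj b a hab.symm
    · obtain rfl := hj.injective hab
      exact hdisj a a (le_antisymm (max_eq_right_iff.mp h₂) (min_eq_right_iff.mp h₁))
  · dsimp only
    rcases le_total (i h) (j h) with hle | hle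
    · rw [min_eq_left hle, max_eq_right hle, heq]
    · rw [min_eq_right hle, max_eq_left hle, heq]
  · exact min_lt_max.mpr (hdisj h h)
end

section
/- If a word W over a finite alphabet contains a pair of twins of length t, then W contains a pair of canonical twins of length t; that is, there exist monotone twins (X, Y) of length t in W such that within every run of W, all positions belonging to the support of X precede all positions belonging to the support of Y, which in turn precede all positions belonging to neither support. -/
/-- Positions `p` and `q` of the word `w` lie in the same run exactly when all letters
between them (inclusive) are equal. -/
def SameRun {α : Type*} (w : List α) (p q : Fin w.length) : Prop :=
  ∀ k : Fin w.length, min p q ≤ k → k ≤ max p q → w.get k = w.get p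

/-- Disjoint, equal, strictly increasing position sequences with `i h < j h` throughout. -/
structure IsMonotoneTwins {α : Type*} (w : List α) {t : ℕ} (i j : Fin t → Fin w.length) :
    Prop where
  strictMono_left : StrictMono i
  strictMono_right : StrictMono j
  disjoint : ∀ h h', i h ≠ j h'
  get_eq : ∀ h, w.get (i h) = w.get (j h)
  lt : ∀ h, i h < j h

/-- Exchanging two adjacent elements preserves the order of every other pair. -/
theorem CovBy.swap_lt_swap {β : Type*} [LinearOrder β] {a b x y : β} (hab : a ⋖ b)
    (hxy : x < y) (h : ¬ (x = a ∧ y = b)) : Equiv.swap a b x < Equiv.swap a b y := by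
  have hlt := hab.lt
  have hx := hab.ge_of_gt (c := x)
  have hy := hab.ge_of_gt (c := y)
  simp only [Equiv.swap_apply_def]
  grind

theorem StrictMono.swap_comp {ι β : Type*} [Preorder ι] [LinearOrder β] {f : ι → β} {a b : β}
    (hf : StrictMono f) (hab : a ⋖ b) (h : ¬ (a ∈ Set.range f ∧ b ∈ Set.range f)) :
    StrictMono (Equiv.swap a b ∘ f) := fun x y hxy =>
  hab.swap_lt_swap (hf hxy) fun e => h ⟨⟨x, e.1⟩, ⟨y, e.2⟩⟩

theorem Equiv.swap_comp_lt {ι β : Type*} [LinearOrder β] {f : ι → β} {a b : β} (hab : a < b)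
    (ha : a ∉ Set.range f) (hb : b ∈ Set.range f) : Equiv.swap a b ∘ f < f := by
  rw [Pi.lt_def]
  constructor
  · intro h
    have : f h ≠ a := fun e => ha ⟨h, e⟩
    simp only [Function.comp_apply, Equiv.swap_apply_def]
    grind
  · obtain ⟨h, rfl⟩ := hb
    exact ⟨h, by simpa using hab⟩

namespace IsMonotoneTwins

variable {α : Type*} {w : List α} {t : ℕ} {i j : Fin t → Fin w.length}

/-- Any pair of twins becomes monotone after taking pointwise minima and maxima. -/
theorem min_max (hi : StrictMono i) (hj : StrictMono j) (hdisj : ∀ h h', i h ≠ j h')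
    (heq : ∀ h, w.get (i h) = w.get (j h)) :
    IsMonotoneTwins w (fun h => min (i h) (j h)) (fun h => max (i h) (j h)) where
  strictMono_left _ _ hab := min_lt_min (hi hab) (hj hab)
  strictMono_right _ _ hab := max_lt_max (hi hab) (hj hab)
  disjoint a b := by
    have h₁ := hdisj a b
    have h₂ := hdisj b a
    have h₃ := hdisj a a
    have h₄ := hi.injective.eq_iff (a := a) (b := b)
    have h₅ := hj.injective.eq_iff (a := a) (b := b)
    grind
  get_eq a := by
    rcases le_total (i a) (j a) with h | h
    · simpa only [min_eq_left h, max_eq_right h] using heq a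
    · simpa only [min_eq_right h, max_eq_left h] using (heq a).symm
  lt a := min_lt_max.mpr (hdisj a a)

/-- Exchanging adjacent positions holding equal letters preserves monotone twins, unless it
would reverse the order of a pair of positions that has to stay in order. -/
theorem swap (T : IsMonotoneTwins w i j) {a b : Fin w.length} (hab : a ⋖ b)
    (hw : w.get a = w.get b) (hl : a ∉ Set.range i)
    (hr : ¬ (a ∈ Set.range j ∧ b ∈ Set.range j)) :
    IsMonotoneTwins w (Equiv.swap a b ∘ i) (Equiv.swap a b ∘ j) := by
  have get_swap : ∀ x, w.get (Equiv.swap a b x) = w.get x := by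
    intro x
    rw [Equiv.swap_apply_def]
    grind
  exact
    { strictMono_left := T.strictMono_left.swap_comp hab fun h => hl h.1
      strictMono_right := T.strictMono_right.swap_comp hab hr
      disjoint := fun h h' e => T.disjoint h h' ((Equiv.swap a b).injective e)
      get_eq := fun h => by
        simpa only [Function.comp_apply, get_swap] using T.get_eq h
      lt := fun h => hab.swap_lt_swap (T.lt h) fun e => hl ⟨h, e.1⟩ }

end IsMonotoneTwins

/-- A set of positions closed under passing to an adjacent earlier position with the same letter
is closed under passing to any earlier position in the same run. -/
theorem SameRun.mem_of_lt {α : Type*} {w : List α} {S : Set (Fin w.length)}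
    (hS : ∀ a b, a ⋖ b → w.get a = w.get b → b ∈ S → a ∈ S) {p q : Fin w.length}
    (hpq : SameRun w p q) (hlt : p < q) (hq : q ∈ S) : p ∈ S := by
  have get_eq : ∀ k, p ≤ k → k ≤ q → w.get k = w.get p := fun k h₁ h₂ =>
    hpq k ((min_le_left _ _).trans h₁) (h₂.trans (le_max_right _ _))
  have mem : ∀ n (k : Fin w.length), k.val + n = q.val → p ≤ k → k ∈ S := by
    intro n
    induction n with
    | zero =>
      intro k hk _
      rwa [Fin.ext (show k.val = q.val from hk)]
    | succ n ih =>
      intro k hk hpk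
      have hk' : k.val + 1 < w.length := by have := q.isLt; omega
      have hcov : k ⋖ ⟨k.val + 1, hk'⟩ := by
        rw [Fin.covBy_iff]
        exact Order.covBy_add_one k.val
      have hle : k ≤ q := by rw [Fin.le_def]; omega
      have hle' : (⟨k.val + 1, hk'⟩ : Fin w.length) ≤ q := by rw [Fin.le_def]; simp only; omega
      refine hS k _ hcov ?_ (ih _ (by simp only; omega) (hpk.trans hcov.le))
      rw [get_eq k hpk hle, get_eq _ (hpk.trans hcov.le) hle']
  exact mem (q.val - p.val) p (by rw [Fin.lt_def] at hlt; omega) le_rfl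

/-- If a word `w` contains a pair of twins of length `t`, then it contains a pair of
*canonical* twins of length `t`: monotone twins `(X, Y)` such that within every run of
`w` all positions of the support of `X` precede all positions of the support of `Y`,
which in turn precede all gaps (positions in neither support). -/
theorem statement17 {α : Type*} [Fintype α] (w : List α) (t : ℕ)
    (i j : Fin t → Fin w.length) (hi : StrictMono i) (hj : StrictMono j)
    (hdisj : ∀ h h', i h ≠ j h')
    (heq : ∀ h, w.get (i h) = w.get (j h)) :
    ∃ i' j' : Fin t → Fin w.length, StrictMono i' ∧ StrictMono j' ∧
      (∀ h h', i' h ≠ j' h') ∧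
      (∀ h, w.get (i' h) = w.get (j' h)) ∧
      (∀ h, i' h < j' h) ∧
      (∀ p q : Fin w.length, SameRun w p q → p < q →
        (q ∈ Set.range i' → p ∈ Set.range i') ∧
        (q ∈ Set.range j' → p ∈ Set.range i' ∪ Set.range j')) := by
  obtain ⟨m, hm, hmin⟩ := Set.Finite.exists_minimal
    (s := {m : (Fin t → Fin w.length) ×ₗ (Fin t → Fin w.length) |
      IsMonotoneTwins w (ofLex m).1 (ofLex m).2})
    (Set.finite_univ_iff.mpr (inferInstanceAs (Finite ((Fin t → Fin w.length) ×
      (Fin t → Fin w.length)))) |>.subset (Set.subset_univ _))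
    ⟨toLex (_, _), IsMonotoneTwins.min_max hi hj hdisj heq⟩
  obtain ⟨⟨i', j'⟩, rfl⟩ := toLex.surjective m
  have T : IsMonotoneTwins w i' j' := hm
  have not_lt : ∀ i'' j'', IsMonotoneTwins w i'' j'' →
      ¬ toLex (i'', j'') < toLex (i', j') := fun i'' j'' T' h =>
    h.not_ge (hmin (y := toLex (i'', j'')) T' h.le)
  have closed_left : ∀ a b, a ⋖ b → w.get a = w.get b →
      b ∈ Set.range i' → a ∈ Set.range i' := by
    intro a b hab hw hb
    by_contra ha
    refine not_lt _ _ (T.swap hab hw ha ?_) ?_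
    · rintro ⟨-, h, e⟩
      obtain ⟨h', e'⟩ := hb
      exact T.disjoint h' h (e'.trans e.symm)
    · exact Prod.Lex.toLex_lt_toLex.mpr (Or.inl (Equiv.swap_comp_lt hab.lt ha hb))
  have closed_union : ∀ a b, a ⋖ b → w.get a = w.get b →
      b ∈ Set.range i' ∪ Set.range j' → a ∈ Set.range i' ∪ Set.range j' := by
    rintro a b hab hw (hb | hb)
    · exact Or.inl (closed_left a b hab hw hb)
    by_contra ha
    rw [Set.mem_union, not_or] at ha
    refine not_lt _ _ (T.swap hab hw ha.1 fun h => ha.2 h.1) ?_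
    refine Prod.Lex.toLex_lt_toLex.mpr (Or.inr ⟨?_, Equiv.swap_comp_lt hab.lt ha.2 hb⟩)
    funext h
    obtain ⟨h', e⟩ := hb
    exact Equiv.swap_apply_of_ne_of_ne (fun e' => ha.1 ⟨h, e'⟩)
      fun e' => T.disjoint h h' (e'.trans e.symm)
  exact ⟨i', j', T.strictMono_left, T.strictMono_right, T.disjoint, T.get_eq, T.lt,
    fun p q hpq hlt => ⟨hpq.mem_of_lt closed_left hlt,
      fun hq => hpq.mem_of_lt closed_union hlt (Or.inr hq)⟩⟩
end
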